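/- arXiv:2312.09664 — 2 statements merged into one kernel-verified Lean document; each statement's English description precedes it below -/
import Mathlib

section
/- Quaternionic Goluzin estimate: let f be a slice regular self-map of 𝔹 with f(0) = 0, with power-series coefficients (aₘ), so that ∂_C f(0) = a₁. Then for every q₀ ∈ 𝔹, |f^h(q₀)| ≤ (|a₁| + 2|q₀|/(1 + |q₀|²)) / (1 + |a₁|·(2|q₀|/(1 + |q₀|²))). -/
noncomputable section

abbrev H : Type := Quaternion ℝ

namespace QPaper

/-- The complex slice determined by `I`: the real span of `1` and `I`. -/
def sliceSet (I : H) : Set H := {q | ∃ x y : ℝ, q = (x : H) + y • I}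

/-- Evaluation of the power series `q ↦ ∑ qᵐ aₘ` with right coefficients. -/
def evalC (a : ℕ → H) (q : H) : H := ∑' m, q ^ m * a m

/-- The series with coefficients `a` converges at every point of the unit ball. -/
def SummableOn (a : ℕ → H) : Prop := ∀ q : H, ‖q‖ < 1 → Summable fun m => q ^ m * a m

/-- `a` are the coefficients of a slice regular self-map of the unit ball. -/
def SelfMap (a : ℕ → H) : Prop :=
  SummableOn a ∧ ∀ q : H, ‖q‖ < 1 → ‖evalC a q‖ < 1

/-- Coefficients of the ∗-product. -/
def starMulC (a b : ℕ → H) : ℕ → H := fun m => ∑ ℓ ∈ Finset.range (m + 1), a (m - ℓ) * b ℓ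

/-- Coefficients of the ∗-inverse (of a series with invertible constant term). -/
def starInvC (a : ℕ → H) : ℕ → H
  | 0 => (a 0)⁻¹
  | m + 1 => -(a 0)⁻¹ * ∑ ℓ : Fin (m + 1), a (m + 1 - ℓ.val) * starInvC a ℓ.val
  decreasing_by exact ℓ.isLt

/-- Coefficients of `1 - q p̄`. -/
def oneMinusQPbarC (p : H) : ℕ → H := fun m => if m = 0 then 1 else if m = 1 then -(star p) else 0

/-- Coefficients of `q - p`. -/
def qMinusPC (p : H) : ℕ → H := fun m => if m = 0 then -p else if m = 1 then 1 else 0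

/-- Coefficients of the regular Möbius transformation `ℳ_p = (1 - q p̄)^{-∗} ∗ (q - p)`. -/
def mobiusC (p : H) : ℕ → H := starMulC (starInvC (oneMinusQPbarC p)) (qMinusPC p)

/-- Coefficients of `ℳ_{t₁} ∗ ⋯ ∗ ℳ_{t_κ}`. -/
def blaschkeListC : List H → (ℕ → H)
  | [] => fun m => if m = 0 then 1 else 0
  | t :: ts => starMulC (mobiusC t) (blaschkeListC ts)

/-- `a` are the coefficients of a regular Blaschke product of degree `κ`,
i.e. of `ℳ_{t₁} ∗ ⋯ ∗ ℳ_{t_κ} u` with the `tᵢ` in `𝔹` and `u` unimodular. -/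
def IsBlaschke (a : ℕ → H) (κ : ℕ) : Prop :=
  ∃ (ts : List H) (u : H), ts.length = κ ∧ (∀ t ∈ ts, ‖t‖ < 1) ∧ ‖u‖ = 1 ∧
    a = fun m => blaschkeListC ts m * u

/-- Coefficients of `ℳ_w ∙ f = (1 - f w̄)^{-∗} ∗ (f - w)`. -/
def bulletC (w : H) (a : ℕ → H) : ℕ → H :=
  starMulC (starInvC (fun m => (if m = 0 then (1 : H) else 0) - a m * star w))
    (fun m => a m - if m = 0 then w else 0)

/-- Coefficients of the regular difference quotient `ℛ_{f,p}`,
the unique slice regular function with `f(q) = f(p) + (q - p) ∗ ℛ_{f,p}(q)`. -/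
def diffQuotC (a : ℕ → H) (p : H) : ℕ → H := fun m => ∑' k, p ^ k * a (k + m + 1)

/-- Coefficients of the hyperbolic difference quotient
`f⋆_p = (1 - q p̄) ∗ ℛ_{f,p} ∗ (1 - \overline{f(p)} f)^{-∗} = ℳ_p^{-∗} ∗ (ℳ_{f(p)} ∙ f)`. -/
def hdqC (a : ℕ → H) (p : H) : ℕ → H :=
  starMulC (starMulC (oneMinusQPbarC p) (diffQuotC a p))
    (starInvC (fun m => (if m = 0 then (1 : H) else 0) - star (evalC a p) * a m))

/-- Iterated hyperbolic difference quotients: `ihdqC a [p₁, …, pₙ] = ((f⋆_{p₁})⋆_{p₂} ⋯)⋆_{pₙ}`. -/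
def ihdqC (a : ℕ → H) : List H → (ℕ → H)
  | [] => a
  | p :: ps => ihdqC (hdqC a p) ps

/-- `𝒯_p(q) = (1 - q p)⁻¹ q (1 - q p)`. -/
def mobiusT (p q : H) : H := (1 - q * p)⁻¹ * q * (1 - q * p)

/-- `M_p(q) = (1 - q p̄)⁻¹ (q - p)`. -/
def mobiusM (p q : H) : H := (1 - q * star p)⁻¹ * (q - p)

/-- Pointwise evaluation of the regular Möbius transformation: `ℳ_p(q) = M_p(𝒯_p(q))`. -/
def mobiusEval (p q : H) : H := mobiusM p (mobiusT p q)

/-- The pseudo-hyperbolic distance `ρ(p,q) = |M_p(q)|`. -/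
def rho (p q : H) : ℝ := ‖mobiusM p q‖

/-- The Poincaré distance `δ(p,q) = tanh⁻¹ ρ(p,q) = ½ log((1+ρ)/(1−ρ))`. -/
def pdist (p q : H) : ℝ := (1/2 : ℝ) * Real.log ((1 + rho p q) / (1 - rho p q))



/-- Truncated square norm. -/
def SN (N : ℕ) (x : PowerSeries H) : ℝ := ∑ m ∈ Finset.range N, ‖PowerSeries.coeff m x‖ ^ 2

def LC (a : PowerSeries H) : Prop := ∀ N x, SN N (a * x) ≤ SN N x
def RC (a : PowerSeries H) : Prop := ∀ N x, SN N (x * a) ≤ SN N x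

lemma SN_nonneg (N : ℕ) (x : PowerSeries H) : 0 ≤ SN N x :=
  Finset.sum_nonneg fun _ _ => by positivity

lemma SN_mono {N M : ℕ} (h : N ≤ M) (x : PowerSeries H) : SN N x ≤ SN M x :=
  Finset.sum_le_sum_of_subset_of_nonneg (Finset.range_mono h) fun _ _ _ => by positivity

lemma SN_term {N m : ℕ} (h : m < N) (x : PowerSeries H) :
    ‖PowerSeries.coeff m x‖ ^ 2 ≤ SN N x :=
  Finset.single_le_sum (f := fun m => ‖PowerSeries.coeff m x‖ ^ 2)
    (fun _ _ => by positivity) (Finset.mem_range.2 h)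

def tr (N : ℕ) (x : PowerSeries H) : PowerSeries H :=
  PowerSeries.mk fun m => if m < N then PowerSeries.coeff m x else 0

lemma coeff_tr (N m : ℕ) (x : PowerSeries H) :
    PowerSeries.coeff m (tr N x) = if m < N then PowerSeries.coeff m x else 0 := by
  simp [tr]

lemma SN_tr (N : ℕ) (x : PowerSeries H) : SN N (tr N x) = SN N x := by
  unfold SN
  refine Finset.sum_congr rfl fun m hm => ?_
  rw [coeff_tr, if_pos (Finset.mem_range.1 hm)]

lemma SN_tr_le (N M : ℕ) (x : PowerSeries H) : SN M (tr N x) ≤ SN N x := by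
  rcases le_total M N with h | h
  · exact (SN_mono h _).trans (SN_tr N x).le
  · rw [← SN_tr N x]
    unfold SN
    refine (Finset.sum_subset (Finset.range_mono h) ?_).ge
    intro m _ hm
    rw [coeff_tr, if_neg (by simpa using hm)]; simp

lemma SN_mul_tr (N : ℕ) (a x : PowerSeries H) : SN N (a * tr N x) = SN N (a * x) := by
  unfold SN
  refine Finset.sum_congr rfl fun m hm => ?_
  rw [PowerSeries.coeff_mul, PowerSeries.coeff_mul]
  congr 2
  refine Finset.sum_congr rfl fun p hp => ?_
  rw [coeff_tr, if_pos]
  have := Finset.HasAntidiagonal.mem_antidiagonal.1 hp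
  have := Finset.mem_range.1 hm
  omega

lemma SN_tr_mul (N : ℕ) (a x : PowerSeries H) : SN N (tr N x * a) = SN N (x * a) := by
  unfold SN
  refine Finset.sum_congr rfl fun m hm => ?_
  rw [PowerSeries.coeff_mul, PowerSeries.coeff_mul]
  congr 2
  refine Finset.sum_congr rfl fun p hp => ?_
  rw [coeff_tr, if_pos]
  have := Finset.HasAntidiagonal.mem_antidiagonal.1 hp
  have := Finset.mem_range.1 hm
  omega

lemma SN_eq_flip (n : ℕ) (x : PowerSeries H) :
    SN (n + 1) x = ∑ k ∈ Finset.range (n + 1), ‖PowerSeries.coeff (n - k) x‖ ^ 2 := by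
  have := Finset.sum_range_reflect (fun k => ‖PowerSeries.coeff k x‖ ^ 2) (n + 1)
  simpa [SN] using this.symm

lemma coeff_mul_bound (n : ℕ) (u v : PowerSeries H) :
    ‖PowerSeries.coeff n (u * v)‖ ^ 2 ≤ SN (n + 1) u * SN (n + 1) v := by
  rw [PowerSeries.coeff_mul,
    Finset.Nat.sum_antidiagonal_eq_sum_range_succ
      (fun i j => PowerSeries.coeff i u * PowerSeries.coeff j v)]
  have h1 : ‖∑ k ∈ Finset.range n.succ, PowerSeries.coeff k u * PowerSeries.coeff (n - k) v‖ ≤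
      ∑ k ∈ Finset.range n.succ, ‖PowerSeries.coeff k u‖ * ‖PowerSeries.coeff (n - k) v‖ := by
    refine (norm_sum_le _ _).trans (Finset.sum_le_sum fun k _ => ?_)
    exact (norm_mul _ _).le
  calc _ ≤ _ := pow_le_pow_left₀ (norm_nonneg _) h1 2
    _ ≤ _ := Finset.sum_mul_sq_le_sq_mul_sq _ _ _
    _ = _ := by rw [SN_eq_flip n v]; rfl

def rv (n : ℕ) (y : PowerSeries H) : PowerSeries H :=
  PowerSeries.mk fun m => star (PowerSeries.coeff (n - m) y)

lemma SN_rv (n : ℕ) (y : PowerSeries H) : SN (n + 1) (rv n y) = SN (n + 1) y := by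
  rw [SN_eq_flip n y]; simp [SN, rv]

lemma coeH_sum (s : Finset ℕ) (f : ℕ → ℝ) : ((∑ k ∈ s, f k : ℝ) : H) = ∑ k ∈ s, ((f k : ℝ) : H) :=
  map_sum (algebraMap ℝ H) f s

lemma norm_rv_mul (n : ℕ) (y : PowerSeries H) :
    ‖PowerSeries.coeff n (rv n y * y)‖ = SN (n + 1) y := by
  have : PowerSeries.coeff n (rv n y * y) = ((SN (n + 1) y : ℝ) : H) := by
    rw [PowerSeries.coeff_mul,
    Finset.Nat.sum_antidiagonal_eq_sum_range_succ
      (fun i j => PowerSeries.coeff i (rv n y) * PowerSeries.coeff j y), SN_eq_flip]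
    simp only [rv, PowerSeries.coeff_mk, Quaternion.star_mul_self, Quaternion.normSq_eq_norm_mul_self]
    rw [coeH_sum]
    simp [pow_two]
  rw [this, Quaternion.norm_coe, Real.norm_of_nonneg (SN_nonneg _ _)]

lemma norm_mul_rv (n : ℕ) (y : PowerSeries H) :
    ‖PowerSeries.coeff n (y * rv n y)‖ = SN (n + 1) y := by
  have : PowerSeries.coeff n (y * rv n y) = ((SN (n + 1) y : ℝ) : H) := by
    rw [PowerSeries.coeff_mul,
    Finset.Nat.sum_antidiagonal_eq_sum_range_succ
      (fun i j => PowerSeries.coeff i y * PowerSeries.coeff j (rv n y))]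
    unfold SN
    rw [coeH_sum]
    refine Finset.sum_congr rfl fun k hk => ?_
    have : n - (n - k) = k := by have := Finset.mem_range.1 hk; omega
    simp only [rv, PowerSeries.coeff_mk, this, Quaternion.self_mul_star,
      Quaternion.normSq_eq_norm_mul_self]
    push_cast
    simp [pow_two]
  rw [this, Quaternion.norm_coe, Real.norm_of_nonneg (SN_nonneg _ _)]

lemma LC_of_RC {a : PowerSeries H} (h : RC a) : LC a := by
  intro N x
  rcases N with _ | n
  · simp [SN]
  have h1 := coeff_mul_bound n (rv n (a * x) * a) x
  rw [mul_assoc, norm_rv_mul] at h1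
  have h2 := h (n + 1) (rv n (a * x))
  rw [SN_rv] at h2
  have h3 := SN_nonneg (n + 1) x
  have h4 := SN_nonneg (n + 1) (a * x)
  by_contra hc
  push Not at hc
  nlinarith [mul_le_mul_of_nonneg_right h2 h3]

lemma RC_of_LC {a : PowerSeries H} (h : LC a) : RC a := by
  intro N x
  rcases N with _ | n
  · simp [SN]
  have h1 := coeff_mul_bound n x (a * rv n (x * a))
  rw [← mul_assoc, norm_mul_rv] at h1
  have h2 := h (n + 1) (rv n (x * a))
  rw [SN_rv] at h2
  have h3 := SN_nonneg (n + 1) x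
  have h4 := SN_nonneg (n + 1) (x * a)
  by_contra hc
  push Not at hc
  nlinarith [mul_le_mul_of_nonneg_left h2 h3]

lemma LC_coeff {a : PowerSeries H} (h : LC a) (m : ℕ) : ‖PowerSeries.coeff m a‖ ≤ 1 := by
  have h1 := h (m + 1) 1
  rw [mul_one] at h1
  have h2 : SN (m + 1) (1 : PowerSeries H) = 1 := by
    simp [SN, PowerSeries.coeff_one, Finset.sum_range_succ']
  have := SN_term (Nat.lt_succ_self m) a
  rw [h2] at h1
  have : ‖PowerSeries.coeff m a‖ ^ 2 ≤ 1 := this.trans h1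
  nlinarith [norm_nonneg (PowerSeries.coeff m a)]

/-- the shift -/
lemma LC_shift {a g : PowerSeries H} (h : LC a) (hg : a = PowerSeries.X * g) : LC g := by
  intro N x
  rw [← SN_mul_tr]
  have h1 := h (N + 1) (tr N x)
  have h2 : SN (N + 1) (a * tr N x) = SN N (g * tr N x) := by
    rw [hg, mul_assoc]
    unfold SN
    rw [Finset.sum_range_succ']
    simp [PowerSeries.coeff_succ_X_mul]
  rw [h2] at h1
  exact h1.trans (SN_tr_le _ _ _)

lemma coeff_mul_flip (m : ℕ) (φ ψ : PowerSeries H) : PowerSeries.coeff m (φ * ψ) =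
    ∑ j ∈ Finset.range (m + 1), PowerSeries.coeff (m - j) φ * PowerSeries.coeff j ψ := by
  rw [PowerSeries.coeff_mul, Finset.Nat.antidiagonal_eq_map', Finset.sum_map]
  rfl

lemma mk_starMulC (a b : ℕ → H) :
    PowerSeries.mk (starMulC a b) = PowerSeries.mk a * PowerSeries.mk b := by
  ext1 m
  rw [coeff_mul_flip]
  simp [starMulC]

lemma mk_starInvC (a : ℕ → H) (h : a 0 ≠ 0) :
    PowerSeries.mk a * PowerSeries.mk (starInvC a) = 1 := by
  ext1 m
  rw [← mk_starMulC, PowerSeries.coeff_mk, PowerSeries.coeff_one]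
  unfold starMulC
  rcases m with _ | m
  · simp [starInvC, h]
  · rw [Finset.sum_range_succ]
    conv_lhs => rw [starInvC]
    rw [Fin.sum_univ_eq_sum_range (fun l => a (m + 1 - l) * starInvC a l)]
    simp [h]

lemma key_id (u z w : H) : ‖u - star w * z‖ ^ 2 + (1 - ‖w‖ ^ 2) * ‖z‖ ^ 2
    = ‖z - w * u‖ ^ 2 + (1 - ‖w‖ ^ 2) * ‖u‖ ^ 2 := by
  simp only [pow_two, ← Quaternion.normSq_eq_norm_mul_self, Quaternion.normSq_def']
  simp
  ring

lemma key_low (u z w : H) :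
    (1 - ‖w‖) * ‖u‖ ^ 2 - (1 - ‖w‖) * ‖w‖ * ‖z‖ ^ 2 ≤ ‖u - star w * z‖ ^ 2 := by
  have h1 : ‖u‖ - ‖w‖ * ‖z‖ ≤ ‖u - star w * z‖ := by
    have := norm_sub_norm_le u (star w * z)
    rwa [norm_mul, norm_star] at this
  have h2 : -(‖u‖ - ‖w‖ * ‖z‖) ≤ ‖u - star w * z‖ := by
    have := norm_sub_norm_le (star w * z) u
    rw [norm_mul, norm_star, norm_sub_rev] at this
    linarith
  have h3 : (‖u‖ - ‖w‖ * ‖z‖) ^ 2 ≤ ‖u - star w * z‖ ^ 2 := by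
    rw [← sq_abs]
    exact pow_le_pow_left₀ (abs_nonneg _) (abs_le'.2 ⟨h1, h2⟩) 2
  nlinarith [mul_nonneg (norm_nonneg w) (sq_nonneg (‖u‖ - ‖z‖))]

lemma coeff_D (A u : PowerSeries H) (w : H) (m : ℕ) :
    PowerSeries.coeff m ((1 - PowerSeries.C (star w) * A) * u) =
      PowerSeries.coeff m u - star w * PowerSeries.coeff m (A * u) := by
  rw [sub_mul, one_mul, mul_assoc, map_sub, PowerSeries.coeff_C_mul]

lemma coeff_E (A u : PowerSeries H) (w : H) (m : ℕ) :
    PowerSeries.coeff m ((A - PowerSeries.C w) * u) =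
      PowerSeries.coeff m (A * u) - w * PowerSeries.coeff m u := by
  rw [sub_mul, map_sub, PowerSeries.coeff_C_mul]

lemma mob_le {A : PowerSeries H} (hA : LC A) {w : H} (hw : ‖w‖ < 1) (N : ℕ) (u : PowerSeries H) :
    SN N ((A - PowerSeries.C w) * u) ≤ SN N ((1 - PowerSeries.C (star w) * A) * u) := by
  have h : SN N ((1 - PowerSeries.C (star w) * A) * u) + (1 - ‖w‖ ^ 2) * SN N (A * u)
      = SN N ((A - PowerSeries.C w) * u) + (1 - ‖w‖ ^ 2) * SN N u := by
    unfold SN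
    rw [Finset.mul_sum, Finset.mul_sum, ← Finset.sum_add_distrib, ← Finset.sum_add_distrib]
    refine Finset.sum_congr rfl fun m _ => ?_
    rw [coeff_D, coeff_E]
    exact key_id _ _ _
  have h1 := hA N u
  have h2 : 0 ≤ 1 - ‖w‖ ^ 2 := by nlinarith [norm_nonneg w]
  nlinarith [mul_le_mul_of_nonneg_left h1 h2]

lemma inv_le {A : PowerSeries H} (hA : LC A) {w : H} (hw : ‖w‖ < 1) (N : ℕ) (u : PowerSeries H) :
    (1 - ‖w‖) ^ 2 * SN N u ≤ SN N ((1 - PowerSeries.C (star w) * A) * u) := by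
  have h : (1 - ‖w‖) * SN N u - (1 - ‖w‖) * ‖w‖ * SN N (A * u) ≤
      SN N ((1 - PowerSeries.C (star w) * A) * u) := by
    unfold SN
    rw [Finset.mul_sum, Finset.mul_sum, ← Finset.sum_sub_distrib]
    refine Finset.sum_le_sum fun m _ => ?_
    rw [coeff_D]
    exact key_low _ _ _
  have h1 := hA N u
  have h2 : 0 ≤ (1 - ‖w‖) * ‖w‖ := mul_nonneg (by linarith) (norm_nonneg w)
  nlinarith [mul_le_mul_of_nonneg_left h1 h2]

lemma summable_pw {a : ℕ → H} (ha : ∀ m, ‖a m‖ ≤ 1) {p : H} (hp : ‖p‖ < 1) (v : H) :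
    Summable fun k => p ^ k * v * a k := by
  refine Summable.of_norm_bounded (g := fun k => ‖p‖ ^ k * ‖v‖)
    ((summable_geometric_of_lt_one (norm_nonneg _) hp).mul_right _) fun k => ?_
  rw [norm_mul, norm_mul, norm_pow]
  exact mul_le_of_le_one_right (by positivity) (ha k)

lemma summable_pw1 {a : ℕ → H} (ha : ∀ m, ‖a m‖ ≤ 1) {p : H} (hp : ‖p‖ < 1) :
    Summable fun k => p ^ k * a k := by
  simpa using summable_pw ha hp 1

lemma split_pw {a : ℕ → H} (ha : ∀ m, ‖a m‖ ≤ 1) {p : H} (hp : ‖p‖ < 1) :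
    ∑' k, p ^ k * a k = a 0 + p * ∑' k, p ^ k * a (k + 1) := by
  rw [(summable_pw1 ha hp).tsum_eq_zero_add, ← tsum_mul_left]
  simp [pow_succ', mul_assoc]

lemma diffQuot_eq {a : ℕ → H} (ha : ∀ m, ‖a m‖ ≤ 1) {p : H} (hp : ‖p‖ < 1) :
    (PowerSeries.X - PowerSeries.C p) * PowerSeries.mk (diffQuotC a p)
      = PowerSeries.mk a - PowerSeries.C (evalC a p) := by
  ext1 m
  rw [sub_mul, map_sub, map_sub, PowerSeries.coeff_C_mul]
  rcases m with _ | m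
  · have := split_pw ha hp
    simp [PowerSeries.coeff_zero_X_mul, evalC, diffQuotC, this]
  · have := split_pw (a := fun k => a (k + m + 1)) (fun k => ha _) hp
    rw [PowerSeries.coeff_succ_X_mul]
    simp only [PowerSeries.coeff_mk, diffQuotC, PowerSeries.coeff_C]
    rw [this]
    simp [add_assoc, add_comm 1 m]

lemma bdd_Ru {a : ℕ → H} (hA : LC (PowerSeries.mk a)) {p : H} (hp : ‖p‖ < 1) (u : PowerSeries H)
    (c : ℝ) (hc : 0 ≤ c) (hu : ∀ N, SN N u ≤ c ^ 2) (m : ℕ) :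
    ‖PowerSeries.coeff m (PowerSeries.mk (diffQuotC a p) * u)‖ ≤ c * (1 - ‖p‖)⁻¹ := by
  have ha : ∀ m, ‖a m‖ ≤ 1 := fun m => by simpa using LC_coeff hA m
  have h1 : HasSum (fun k => p ^ k * PowerSeries.coeff (k + 1 + m) (PowerSeries.mk a * tr (m + 1) u))
      (PowerSeries.coeff m (PowerSeries.mk (diffQuotC a p) * u)) := by
    rw [coeff_mul_flip]
    have h2 : ∀ j ∈ Finset.range (m + 1), HasSum (fun k => p ^ k * a (k + (m - j) + 1)
        * PowerSeries.coeff j u) (diffQuotC a p (m - j) * PowerSeries.coeff j u) := fun j _ =>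
      (summable_pw1 (a := fun k => a (k + (m - j) + 1)) (fun k => ha _) hp).hasSum.mul_right _
    have h3 := hasSum_sum h2
    simp only [PowerSeries.coeff_mk]
    convert h3 using 2 with k
    rw [coeff_mul_flip, Finset.mul_sum]
    simp only [PowerSeries.coeff_mk]
    symm
    refine Finset.sum_subset_zero_on_sdiff (Finset.range_mono (by omega)) ?_ ?_
    · intro j hj
      simp only [Finset.mem_sdiff, Finset.mem_range] at hj
      rw [coeff_tr, if_neg hj.2]; simp
    · intro j hj
      have := Finset.mem_range.1 hj
      rw [coeff_tr, if_pos this, mul_assoc]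
      congr 4
      omega
  have h4 : ∀ n, ‖PowerSeries.coeff n (PowerSeries.mk a * tr (m + 1) u)‖ ≤ c := fun n => by
    refine le_of_sq_le_sq ?_ hc
    exact (SN_term (Nat.lt_succ_self n) _).trans ((hA _ _).trans ((SN_tr_le _ _ _).trans (hu _)))
  rw [← h1.tsum_eq]
  refine tsum_of_norm_bounded ((hasSum_geometric_of_lt_one (norm_nonneg p) hp).mul_left c) fun k => ?_
  rw [norm_mul, norm_pow, mul_comm]
  exact mul_le_mul_of_nonneg_right (h4 _) (by positivity)

lemma tend_y {p : H} (hp : ‖p‖ < 1) (y e : ℕ → H) (K : ℝ) (hy : ∀ m, ‖y m‖ ≤ K)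
    (he : Filter.Tendsto (fun m => ‖e m‖) Filter.atTop (nhds 0))
    (hr : ∀ m, y m = e (m + 1) + p * y (m + 1)) :
    Filter.Tendsto (fun m => ‖y m‖) Filter.atTop (nhds 0) := by
  have hp1 : 0 < 1 - ‖p‖ := by linarith
  rw [Metric.tendsto_atTop]
  intro ε hε
  obtain ⟨M, hM⟩ := (Metric.tendsto_atTop.1 he) (ε / 2 * (1 - ‖p‖)) (by positivity)
  refine ⟨M, fun m hm => ?_⟩
  have key : ∀ n, ∀ m ≥ M, ‖y m‖ ≤ ε / 2 + ‖p‖ ^ n * K := by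
    intro n
    induction n with
    | zero => intro m _; have := hy m; simp; linarith
    | succ n ih =>
      intro m hm
      have h1 := ih (m + 1) (by omega)
      have h2 := hM (m + 1) (by omega)
      simp only [dist_zero_right, norm_norm] at h2
      have h3 : ‖y m‖ ≤ ‖e (m + 1)‖ + ‖p‖ * ‖y (m + 1)‖ := by
        rw [hr m]; exact (norm_add_le _ _).trans (by rw [norm_mul])
      have h4 := mul_le_mul_of_nonneg_left h1 (norm_nonneg p)
      rw [pow_succ]
      nlinarith
  have h5 : ‖y m‖ ≤ ε / 2 + 0 * K := by
    refine ge_of_tendsto' (((tendsto_pow_atTop_nhds_zero_of_lt_one (norm_nonneg p) hp).mul_const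
      K).const_add (ε / 2)) fun n => key n m hm
  simp only [dist_zero_right, norm_norm]
  linarith

lemma inner_id (p : H) (y : PowerSeries H) (n : ℕ) :
    SN (n + 1) ((1 - PowerSeries.C (star p) * PowerSeries.X) * y) =
      SN (n + 1) ((PowerSeries.X - PowerSeries.C p) * y)
        + (1 - ‖p‖ ^ 2) * ‖PowerSeries.coeff n y‖ ^ 2 := by
  induction n with
  | zero =>
    simp only [SN, zero_add, Finset.sum_range_one]
    rw [coeff_D, coeff_E, PowerSeries.coeff_zero_X_mul]
    have := key_id (PowerSeries.coeff 0 y) 0 p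
    simpa using this
  | succ n ih =>
    unfold SN at *
    rw [Finset.sum_range_succ, ih, Finset.sum_range_succ _ (n + 1)]
    rw [coeff_D, coeff_E, PowerSeries.coeff_succ_X_mul]
    have := key_id (PowerSeries.coeff (n + 1) y) (PowerSeries.coeff n y) p
    linarith

lemma mk_oneMinus (p : H) :
    PowerSeries.mk (oneMinusQPbarC p) = 1 - PowerSeries.C (star p) * PowerSeries.X := by
  ext1 m
  rw [PowerSeries.coeff_mk, map_sub, PowerSeries.coeff_C_mul, PowerSeries.coeff_one,
    PowerSeries.coeff_X]
  unfold oneMinusQPbarC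
  rcases m with _ | _ | m <;> simp

lemma hdq_LC {a : ℕ → H} (hA : LC (PowerSeries.mk a)) (h0 : a 0 = 0) {p : H} (hp : ‖p‖ < 1)
    (hw : ‖evalC a p‖ < 1) : LC (PowerSeries.mk (hdqC a p)) := by
  have ha : ∀ m, ‖a m‖ ≤ 1 := fun m => by simpa using LC_coeff hA m
  set w := evalC a p with hwdef
  set A := PowerSeries.mk a with hAdef
  set B := PowerSeries.mk (starInvC (fun m => (if m = 0 then (1 : H) else 0) - star w * a m)) with hB
  set R := PowerSeries.mk (diffQuotC a p) with hR
  have hD : PowerSeries.mk (fun m => (if m = 0 then (1 : H) else 0) - star w * a m)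
      = 1 - PowerSeries.C (star w) * A := by
    ext1 m
    rw [map_sub, PowerSeries.coeff_C_mul, PowerSeries.coeff_one]
    simp [hAdef]
  have hDB : (1 - PowerSeries.C (star w) * A) * B = 1 := by
    rw [← hD]; exact mk_starInvC _ (by simp [h0])
  have hh : PowerSeries.mk (hdqC a p) = (1 - PowerSeries.C (star p) * PowerSeries.X) * R * B := by
    unfold hdqC
    rw [mk_starMulC, mk_starMulC, mk_oneMinus]
  have hXR := diffQuot_eq ha hp
  rw [← hR, ← hAdef, ← hwdef] at hXR
  intro N x
  rw [hh, ← SN_mul_tr]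
  set x' := tr N x with hx'
  set u := B * x' with hu
  set y := R * u with hy
  have hDu : (1 - PowerSeries.C (star w) * A) * u = x' := by
    rw [hu, ← mul_assoc, hDB, one_mul]
  have hXy : (PowerSeries.X - PowerSeries.C p) * y = (A - PowerSeries.C w) * u := by
    rw [hy, ← mul_assoc, hXR]
  have he : ∀ M, SN M ((A - PowerSeries.C w) * u) ≤ SN N x := fun M => by
    refine (mob_le hA hw M u).trans ?_
    rw [hDu]; exact SN_tr_le _ _ _
  have hw1 : 0 < 1 - ‖w‖ := by linarith
  have hub : ∀ M, SN M u ≤ (Real.sqrt (SN N x) / (1 - ‖w‖)) ^ 2 := fun M => by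
    have h1 := inv_le hA hw M u
    rw [hDu] at h1
    rw [div_pow, Real.sq_sqrt (SN_nonneg _ _), le_div_iff₀ (by positivity), mul_comm]
    exact h1.trans (SN_tr_le _ _ _)
  have hyb := bdd_Ru hA hp u _ (by positivity) hub
  have hs : Summable fun m => ‖PowerSeries.coeff m ((A - PowerSeries.C w) * u)‖ ^ 2 :=
    summable_of_sum_range_le (fun _ => by positivity) he
  have het : Filter.Tendsto (fun m => ‖PowerSeries.coeff m ((A - PowerSeries.C w) * u)‖)
      Filter.atTop (nhds 0) := by
    have := hs.tendsto_atTop_zero.sqrt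
    simpa using this
  have hyt := tend_y hp (fun m => PowerSeries.coeff m y) _ _ hyb het (fun m => by
    rw [← hXy, coeff_E, PowerSeries.coeff_succ_X_mul]; simp)
  have hfin : ∀ n ≥ N, SN N ((1 - PowerSeries.C (star p) * PowerSeries.X) * y)
      ≤ SN N x + (1 - ‖p‖ ^ 2) * ‖PowerSeries.coeff n y‖ ^ 2 := fun n hn => by
    refine (SN_mono (show N ≤ n + 1 by omega) _).trans ?_
    rw [inner_id, hXy]
    have := he (n + 1)
    linarith
  have hlim : Filter.Tendsto (fun n => SN N x + (1 - ‖p‖ ^ 2) * ‖PowerSeries.coeff n y‖ ^ 2)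
      Filter.atTop (nhds (SN N x + (1 - ‖p‖ ^ 2) * 0 ^ 2)) :=
    ((hyt.pow 2).const_mul _).const_add _
  rw [mul_assoc, mul_assoc]
  have := ge_of_tendsto hlim (Filter.eventually_atTop.2 ⟨N, hfin⟩)
  simpa using this

lemma pick_fin {a : ℕ → H} (hA : RC (PowerSeries.mk a)) (p c0 c : H) (n : ℕ) :
    ‖star c * (∑ i ∈ Finset.range (n + 1), p ^ i * a i) + star c0 * a 0‖ ^ 2 +
      ∑ j ∈ Finset.range n, (‖p‖ ^ (j + 1)) ^ 2 * ‖c‖ ^ 2 *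
        ‖∑ i ∈ Finset.range (n - (j + 1) + 1), p ^ i * a i‖ ^ 2
      ≤ ‖c + c0‖ ^ 2 + ∑ j ∈ Finset.range n, (‖p‖ ^ (j + 1)) ^ 2 * ‖c‖ ^ 2 := by
  set z : PowerSeries H := PowerSeries.mk fun m => star p ^ m * c + if m = 0 then c0 else 0 with hz
  have h := hA (n + 1) (rv n z)
  rw [SN_rv] at h
  have hr : SN (n + 1) z = ‖c + c0‖ ^ 2 +
      ∑ j ∈ Finset.range n, (‖p‖ ^ (j + 1)) ^ 2 * ‖c‖ ^ 2 := by
    unfold SN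
    rw [Finset.sum_range_succ', add_comm]
    simp [hz, mul_pow]
  have hc : ∀ j ≤ n, PowerSeries.coeff (n - j) (rv n z * PowerSeries.mk a) =
      star c * p ^ j * (∑ i ∈ Finset.range (n - j + 1), p ^ i * a i) +
        if j = 0 then star c0 * a 0 else 0 := by
    intro j hj
    rw [coeff_mul_flip]
    have : ∀ i ∈ Finset.range (n - j + 1), PowerSeries.coeff (n - j - i) (rv n z) *
        PowerSeries.coeff i (PowerSeries.mk a) = star c * p ^ j * (p ^ i * a i) +
          if j + i = 0 then star c0 * a 0 else 0 := by
      intro i hi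
      have := Finset.mem_range.1 hi
      have e : n - (n - j - i) = j + i := by omega
      simp only [rv, PowerSeries.coeff_mk, hz, e]
      by_cases h0 : j + i = 0
      · have hj0 : j = 0 := by omega
        have hi0 : i = 0 := by omega
        subst hj0; subst hi0
        simp [add_mul]
      · rw [if_neg h0, if_neg h0, add_zero, add_zero, star_mul, star_pow, star_star, pow_add]
        simp only [mul_assoc]
    rw [Finset.sum_congr rfl this, Finset.sum_add_distrib, ← Finset.mul_sum]
    congr 1
    by_cases hj0 : j = 0
    · subst hj0; simp
    · simp [hj0]
  rw [hr, SN_eq_flip, Finset.sum_range_succ', hc 0 (Nat.zero_le _)] at h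
  rw [add_comm]
  refine le_trans (le_of_eq ?_) h
  congr 1
  · refine Finset.sum_congr rfl fun j hj => ?_
    rw [hc (j + 1) (by have := Finset.mem_range.1 hj; omega)]
    rw [if_neg (Nat.succ_ne_zero j), add_zero, norm_mul, norm_mul, norm_star, norm_pow]
    ring
  · simp

lemma pick {a : ℕ → H} (hA : LC (PowerSeries.mk a)) {p : H} (hp : ‖p‖ < 1) (c0 c : H) :
    ‖star c * evalC a p + star c0 * a 0‖ ^ 2 +
      ‖p‖ ^ 2 / (1 - ‖p‖ ^ 2) * (‖c‖ ^ 2 * ‖evalC a p‖ ^ 2)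
      ≤ ‖c + c0‖ ^ 2 + ‖p‖ ^ 2 / (1 - ‖p‖ ^ 2) * ‖c‖ ^ 2 := by
  have ha : ∀ m, ‖a m‖ ≤ 1 := fun m => by simpa using LC_coeff hA m
  have hp2 : ‖p‖ ^ 2 < 1 := by nlinarith [norm_nonneg p]
  have hT : HasSum (fun j : ℕ => (‖p‖ ^ (j + 1)) ^ 2) (‖p‖ ^ 2 / (1 - ‖p‖ ^ 2)) := by
    have := (hasSum_geometric_of_lt_one (sq_nonneg ‖p‖) hp2).mul_left (‖p‖ ^ 2)
    rw [div_eq_mul_inv]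
    have e : (fun j : ℕ => (‖p‖ ^ (j + 1)) ^ 2) = fun j : ℕ => ‖p‖ ^ 2 * (‖p‖ ^ 2) ^ j := by
      funext j; ring
    rw [e]; exact this
  have hcn : Filter.Tendsto (fun n => ∑ i ∈ Finset.range (n + 1), p ^ i * a i) Filter.atTop
      (nhds (evalC a p)) :=
    (Filter.tendsto_add_atTop_iff_nat 1).2 (summable_pw1 ha hp).hasSum.tendsto_sum_nat
  have h1 : ∀ J : ℕ, ‖star c * evalC a p + star c0 * a 0‖ ^ 2 +
      ∑ j ∈ Finset.range J, (‖p‖ ^ (j + 1)) ^ 2 * ‖c‖ ^ 2 * ‖evalC a p‖ ^ 2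
      ≤ ‖c + c0‖ ^ 2 + ‖p‖ ^ 2 / (1 - ‖p‖ ^ 2) * ‖c‖ ^ 2 := by
    intro J
    refine le_of_tendsto (f := fun n : ℕ =>
      ‖star c * (∑ i ∈ Finset.range (n + 1), p ^ i * a i) + star c0 * a 0‖ ^ 2 +
      ∑ j ∈ Finset.range J, (‖p‖ ^ (j + 1)) ^ 2 * ‖c‖ ^ 2 *
        ‖∑ i ∈ Finset.range (n - (j + 1) + 1), p ^ i * a i‖ ^ 2) ?_
        (Filter.eventually_atTop.2 ⟨J, fun n hn => ?_⟩)
    · refine Filter.Tendsto.add (((hcn.const_mul _).add_const _).norm.pow 2) ?_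
      refine tendsto_finsetSum _ fun j _ => ?_
      exact ((hcn.comp (Filter.tendsto_sub_atTop_nat (j + 1))).norm.pow 2).const_mul _
    · refine le_trans ?_ ((pick_fin (RC_of_LC hA) p c0 c n).trans ?_)
      · gcongr
      · rw [← Finset.sum_mul]
        gcongr
        exact sum_le_hasSum _ (fun _ _ => by positivity) hT
  have h2 : Filter.Tendsto (fun J : ℕ => ‖star c * evalC a p + star c0 * a 0‖ ^ 2 +
      ∑ j ∈ Finset.range J, (‖p‖ ^ (j + 1)) ^ 2 * ‖c‖ ^ 2 * ‖evalC a p‖ ^ 2) Filter.atTop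
      (nhds (‖star c * evalC a p + star c0 * a 0‖ ^ 2 +
      ‖p‖ ^ 2 / (1 - ‖p‖ ^ 2) * (‖c‖ ^ 2 * ‖evalC a p‖ ^ 2))) := by
    refine Filter.Tendsto.const_add _ ?_
    have := (hT.mul_right (‖c‖ ^ 2 * ‖evalC a p‖ ^ 2)).tendsto_sum_nat
    simpa only [mul_assoc] using this
  exact le_of_tendsto' h2 h1

lemma SP {a : ℕ → H} (hA : LC (PowerSeries.mk a)) {p : H} (hp : ‖p‖ < 1) :
    ‖evalC a p‖ ≤ 1 ∧ ‖evalC a p‖ * (1 + ‖a 0‖ * ‖p‖) ≤ ‖a 0‖ + ‖p‖ := by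
  have ha : ‖a 0‖ ≤ 1 := by simpa using LC_coeff hA 0
  have hp2 : 0 < 1 - ‖p‖ ^ 2 := by nlinarith [norm_nonneg p]
  have hb : ‖evalC a p‖ ≤ 1 := by
    have h := pick hA hp 0 1
    simp at h
    have hT : 0 ≤ ‖p‖ ^ 2 / (1 - ‖p‖ ^ 2) := by positivity
    have : ‖evalC a p‖ ^ 2 ≤ 1 := by
      by_contra hc
      push Not at hc
      nlinarith
    nlinarith [norm_nonneg (evalC a p)]
  refine ⟨hb, ?_⟩
  set b := evalC a p with hbdef
  rcases ha.eq_or_lt with h1 | h1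
  · rw [h1]; nlinarith [norm_nonneg p]
  set d : H := 1 - a 0 * star b with hd
  set t : ℝ := 1 - ‖a 0‖ ^ 2 with ht
  have ht0 : 0 < t := by nlinarith [norm_nonneg (a 0)]
  have h := pick hA hp (-d) (t : H)
  have e1 : ‖(t : H) + -d‖ ^ 2 = t ^ 2 - 2 * t * inner ℝ 1 d + ‖d‖ ^ 2 := by
    rw [← sub_eq_add_neg, norm_sub_sq_real]
    simp [Quaternion.inner_def]
    ring
  have e2 : ‖star (t : H) * b + star (-d) * a 0‖ ^ 2 =
      t ^ 2 * ‖b‖ ^ 2 - 2 * t * inner ℝ (a 0 * star b) d + ‖a 0‖ ^ 2 * ‖d‖ ^ 2 := by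
    have : star (t : H) * b + star (-d) * a 0 = star (t : H) * b - star d * a 0 := by
      rw [star_neg, neg_mul, sub_eq_add_neg]
    rw [this, norm_sub_sq_real]
    simp [Quaternion.inner_def, mul_pow]
    ring
  have e3 : inner ℝ 1 d - inner ℝ (a 0 * star b) d = ‖d‖ ^ 2 := by
    rw [← inner_sub_left, ← hd, real_inner_self_eq_norm_sq]
  rw [← hbdef, e1, e2] at h
  simp only [Quaternion.norm_coe, Real.norm_eq_abs, sq_abs] at h
  have h3 : ‖d‖ ^ 2 * (1 - ‖p‖ ^ 2) ≤ (1 - ‖a 0‖ ^ 2) * (1 - ‖b‖ ^ 2) := by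
    have h4 : 0 ≤ t ^ 2 * (1 - ‖b‖ ^ 2) * (1 + ‖p‖ ^ 2 / (1 - ‖p‖ ^ 2)) - 2 * t * ‖d‖ ^ 2
        + t * ‖d‖ ^ 2 := by
      rw [← e3] at *
      rw [ht] at *
      nlinarith
    have h5 : 1 + ‖p‖ ^ 2 / (1 - ‖p‖ ^ 2) = (1 - ‖p‖ ^ 2)⁻¹ := by
      field_simp; ring
    rw [h5] at h4
    have h6 : 0 ≤ t * (t * (1 - ‖b‖ ^ 2) * (1 - ‖p‖ ^ 2)⁻¹ - ‖d‖ ^ 2) := by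
      linarith
    have h7 := nonneg_of_mul_nonneg_right h6 ht0
    rw [← div_eq_mul_inv] at h7
    exact (le_div_iff₀ hp2).1 (by linarith)
  have h8 : 1 - ‖a 0‖ * ‖b‖ ≤ ‖d‖ := by
    have := norm_sub_norm_le (1 : H) (a 0 * star b)
    rwa [norm_mul, norm_star, norm_one] at this
  have h9 : 0 ≤ 1 - ‖a 0‖ * ‖b‖ := by nlinarith [norm_nonneg (a 0), norm_nonneg b]
  have h10 : (1 - ‖a 0‖ * ‖b‖) ^ 2 ≤ ‖d‖ ^ 2 := pow_le_pow_left₀ h9 h8 2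
  have h11 : (‖b‖ - ‖a 0‖) ^ 2 ≤ (‖p‖ * (1 - ‖a 0‖ * ‖b‖)) ^ 2 := by
    nlinarith [mul_le_mul_of_nonneg_right h10 hp2.le]
  have := (abs_le.1 (abs_le_of_sq_le_sq h11 (mul_nonneg (norm_nonneg _) h9))).2
  nlinarith

lemma conj_pow_H (v z : H) (hv : v ≠ 0) (j : ℕ) : v * (v⁻¹ * z * v) ^ j = z ^ j * v := by
  induction j with
  | zero => simp
  | succ j ih =>
    rw [pow_succ, ← mul_assoc, ih, pow_succ]
    simp only [mul_assoc]
    rw [mul_inv_cancel_left₀ hv]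

lemma twist {a : ℕ → H} (ha : SelfMap a) {z : H} (hz : ‖z‖ < 1) (v : H) :
    Summable (fun j => z ^ j * v * a j) ∧ ‖∑' j, z ^ j * v * a j‖ ≤ ‖v‖ := by
  by_cases hv : v = 0
  · subst hv; simp [summable_zero]
  have hn : ‖v⁻¹ * z * v‖ < 1 := by
    rw [norm_mul, norm_mul, norm_inv, mul_comm, mul_inv_cancel_left₀ (norm_ne_zero_iff.2 hv)]
    exact hz
  have e : (fun j => z ^ j * v * a j) = fun j => v * ((v⁻¹ * z * v) ^ j * a j) := by
    funext j; rw [← mul_assoc, conj_pow_H v z hv]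
  rw [e]
  refine ⟨(ha.1 _ hn).mul_left v, ?_⟩
  rw [tsum_mul_left, norm_mul]
  exact mul_le_of_le_one_right (norm_nonneg _) (ha.2 _ hn).le

lemma eval_mul {a : ℕ → H} (ha : SelfMap a) {z : H} (hz : ‖z‖ < 1) (N : ℕ) (x : PowerSeries H)
    (hx : ∀ m, N ≤ m → PowerSeries.coeff m x = 0) :
    HasSum (fun m => z ^ m * PowerSeries.coeff m (x * PowerSeries.mk a))
      (∑' j, z ^ j * (∑ i ∈ Finset.range N, z ^ i * PowerSeries.coeff i x) * a j) := by
  have h1 : ∀ i ∈ Finset.range N, HasSum (fun j => z ^ i * (z ^ j * PowerSeries.coeff i x * a j))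
      (z ^ i * ∑' j, z ^ j * PowerSeries.coeff i x * a j) := fun i _ =>
    (twist ha hz _).1.hasSum.mul_left _
  have h2 := hasSum_sum h1
  have h3 : (fun j => ∑ i ∈ Finset.range N, z ^ i * (z ^ j * PowerSeries.coeff i x * a j)) =
      fun j => z ^ j * (∑ i ∈ Finset.range N, z ^ i * PowerSeries.coeff i x) * a j := by
    funext j
    rw [Finset.mul_sum, Finset.sum_mul]
    refine Finset.sum_congr rfl fun i _ => ?_
    simp only [← mul_assoc]
    rw [← pow_add, ← pow_add, add_comm]
  rw [h3] at h2
  rw [h2.tsum_eq]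
  have h4 : ∀ i ∈ Finset.range N, HasSum
      (fun m => if i ≤ m then z ^ m * (PowerSeries.coeff i x * a (m - i)) else 0)
      (z ^ i * ∑' j, z ^ j * PowerSeries.coeff i x * a j) := by
    intro i hi
    rw [← Function.Injective.hasSum_iff (g := fun j => j + i) (add_left_injective i)]
    · convert h1 i hi using 2 with j
      simp only [Function.comp, Nat.le_add_left, if_true, Nat.add_sub_cancel]
      rw [add_comm, pow_add]
      simp only [mul_assoc]
    · intro m hm
      rw [if_neg]
      intro h
      exact hm ⟨m - i, Nat.sub_add_cancel h⟩
  have h5 := hasSum_sum h4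
  convert h5 using 2 with m
  rw [PowerSeries.coeff_mul, Finset.Nat.sum_antidiagonal_eq_sum_range_succ
      (fun i j => PowerSeries.coeff i x * PowerSeries.coeff j (PowerSeries.mk a)), Finset.mul_sum,
      ← Finset.sum_filter]
  have h6 : ∀ i ∈ Finset.range (m + 1), i ∉ (Finset.range N).filter (fun i => i ≤ m) →
      z ^ m * (PowerSeries.coeff i x * PowerSeries.coeff (m - i) (PowerSeries.mk a)) = 0 := by
    intro i hi hi2
    simp only [Finset.mem_range, Finset.mem_filter] at hi hi2
    rw [hx i (by omega)]; simp
  rw [← Finset.sum_subset _ h6]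
  · simp
  · intro i hi
    simp only [Finset.mem_range, Finset.mem_filter] at hi ⊢
    omega

lemma inner_unit (u y w : H) (hu : ‖u‖ = 1) : inner ℝ (u * y) (u * w) = inner ℝ y w := by
  have h : inner ℝ (u * y) (u * w) = ‖u‖ ^ 2 * inner ℝ y w := by
    simp only [pow_two, ← Quaternion.normSq_eq_norm_mul_self, Quaternion.normSq_def',
      Quaternion.inner_def]
    simp
    ring
  rw [h, hu]; simp

lemma orth {n : ℕ} {ζ : H} (h1 : ‖ζ‖ = 1) (hn : ζ ^ n = 1)
    (hd : ∀ d, 0 < d → d < n → ζ ^ d ≠ 1) (y w : H) {m l : ℕ} (hm : m < l) (hl : l < n) :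
    ∑ k ∈ Finset.range n, inner ℝ ((ζ ^ k) ^ m * y) ((ζ ^ k) ^ l * w) = 0 := by
  obtain ⟨d, rfl⟩ := Nat.exists_eq_add_of_lt hm
  have e : ∀ k ∈ Finset.range n, inner ℝ ((ζ ^ k) ^ m * y) ((ζ ^ k) ^ (m + d + 1) * w)
      = inner ℝ y ((ζ ^ (d + 1)) ^ k * w) := by
    intro k _
    rw [add_assoc, pow_add, mul_assoc, inner_unit _ _ _ (by simp [h1]), ← pow_mul, ← pow_mul,
      mul_comm k]
  rw [Finset.sum_congr rfl e, ← inner_sum, ← Finset.sum_mul]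
  have h2 := mul_geom_sum (ζ ^ (d + 1)) n
  rw [← pow_mul, mul_comm (d + 1), pow_mul, hn, one_pow, sub_self] at h2
  have h3 : ζ ^ (d + 1) - 1 ≠ 0 := sub_ne_zero.2 (hd _ (by omega) (by omega))
  rw [(mul_eq_zero.1 h2).resolve_left h3]
  simp

lemma parseval {n : ℕ} {ζ : H} (h1 : ‖ζ‖ = 1) (hn : ζ ^ n = 1)
    (hd : ∀ d, 0 < d → d < n → ζ ^ d ≠ 1) (y : ℕ → H) :
    ∑ k ∈ Finset.range n, ‖∑ m ∈ Finset.range n, (ζ ^ k) ^ m * y m‖ ^ 2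
      = n * ∑ m ∈ Finset.range n, ‖y m‖ ^ 2 := by
  have e : ∀ k, ‖∑ m ∈ Finset.range n, (ζ ^ k) ^ m * y m‖ ^ 2 =
      ∑ m ∈ Finset.range n, ∑ l ∈ Finset.range n,
        inner ℝ ((ζ ^ k) ^ m * y m) ((ζ ^ k) ^ l * y l) := by
    intro k
    rw [← real_inner_self_eq_norm_sq, sum_inner]
    refine Finset.sum_congr rfl fun m _ => ?_
    rw [inner_sum]
  simp only [e]
  rw [Finset.sum_comm, Finset.mul_sum]
  refine Finset.sum_congr rfl fun m hm => ?_
  rw [Finset.sum_comm, Finset.sum_eq_single_of_mem m hm]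
  · have : ∀ k ∈ Finset.range n, inner ℝ ((ζ ^ k) ^ m * y m) ((ζ ^ k) ^ m * y m) = ‖y m‖ ^ 2 := by
      intro k _
      rw [inner_unit _ _ _ (by simp [h1]), real_inner_self_eq_norm_sq]
    rw [Finset.sum_congr rfl this]; simp
  · intro l hl hlm
    have hm' := Finset.mem_range.1 hm
    have hl' := Finset.mem_range.1 hl
    rcases lt_or_gt_of_ne hlm with h | h
    · rw [← orth h1 hn hd (y l) (y m) h hm']
      exact Finset.sum_congr rfl fun k _ => real_inner_comm _ _
    · exact orth h1 hn hd _ _ h hl'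

lemma exists_root (n : ℕ) (hn : n ≠ 0) : ∃ ζ : H, ‖ζ‖ = 1 ∧ ζ ^ n = 1 ∧
    ∀ d, 0 < d → d < n → ζ ^ d ≠ 1 := by
  have h := Complex.isPrimitiveRoot_exp n hn
  set w := Complex.exp (2 * ↑Real.pi * Complex.I / ↑n)
  have hi : Function.Injective Quaternion.ofComplex := Quaternion.ofComplex.toRingHom.injective
  have hz : (Quaternion.ofComplex w : H) ^ n = 1 := by
    rw [← map_pow, h.pow_eq_one, map_one]
  refine ⟨Quaternion.ofComplex w, ?_, hz, fun d h1 h2 h3 => ?_⟩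
  swap
  · rw [← map_pow, ← map_one Quaternion.ofComplex] at h3
    exact h.pow_ne_one_of_pos_of_lt h1.ne' h2 (hi h3)
  have := congrArg norm hz
  rw [norm_pow, norm_one] at this
  exact (pow_eq_one_iff_of_nonneg (norm_nonneg _) hn).1 this

lemma parseval_r (n : ℕ) (hn : n ≠ 0) (r : ℝ) (hr : 0 ≤ r) : ∃ z : ℕ → H, (∀ k, ‖z k‖ = r) ∧
    ∀ y : ℕ → H, ∑ k ∈ Finset.range n, ‖∑ m ∈ Finset.range n, z k ^ m * y m‖ ^ 2
      = n * ∑ m ∈ Finset.range n, (r ^ m * ‖y m‖) ^ 2 := by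
  obtain ⟨ζ, h1, h2, h3⟩ := exists_root n hn
  refine ⟨fun k => r • ζ ^ k, fun k => by simp [norm_smul, h1, abs_of_nonneg hr], fun y => ?_⟩
  have := parseval h1 h2 h3 (fun m => r ^ m • y m)
  simp only [norm_smul, norm_pow, Real.norm_of_nonneg hr, mul_smul_comm] at this
  simpa only [smul_pow, smul_mul_assoc] using this

lemma RC_r {a : ℕ → H} (ha : SelfMap a) (N : ℕ) (x : PowerSeries H)
    (hx : ∀ m, N ≤ m → PowerSeries.coeff m x = 0) {r : ℝ} (hr : 0 ≤ r) (hr1 : r < 1) :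
    ∑ m ∈ Finset.range N, (r ^ m * ‖PowerSeries.coeff m (x * PowerSeries.mk a)‖) ^ 2 ≤
      ∑ m ∈ Finset.range N, (r ^ m * ‖PowerSeries.coeff m x‖) ^ 2 := by
  set y := fun m => PowerSeries.coeff m (x * PowerSeries.mk a) with hy
  have hev := fun (z : H) (hz : ‖z‖ < 1) => eval_mul ha hz N x hx
  have hs : Summable fun m => r ^ m * ‖y m‖ := by
    have h := (hev (r : H) (by simpa [abs_of_nonneg hr] using hr1)).summable
    have := summable_norm_iff.2 h
    simpa [abs_of_nonneg hr] using this
  set ε : ℕ → ℝ := fun n => ∑' m, r ^ (m + n) * ‖y (m + n)‖ with hε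
  have hε0 : ∀ n, 0 ≤ ε n := fun n => tsum_nonneg fun m => by positivity
  have hεt : Filter.Tendsto ε Filter.atTop (nhds 0) :=
    tendsto_sum_nat_add fun m => r ^ m * ‖y m‖
  set C := ∑ i ∈ Finset.range N, ‖PowerSeries.coeff i x‖ with hC
  have hfin : ∀ n ≥ N + 1, ∑ m ∈ Finset.range N, (r ^ m * ‖y m‖) ^ 2 ≤
      ∑ m ∈ Finset.range N, (r ^ m * ‖PowerSeries.coeff m x‖) ^ 2 + (2 * C * ε n + ε n ^ 2) := by
    intro n hn
    obtain ⟨z, hz, hP⟩ := parseval_r n (by omega) r hr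
    have h1 : ∀ k, ‖∑ m ∈ Finset.range n, z k ^ m * y m‖ ^ 2 ≤
        ‖∑ m ∈ Finset.range n, z k ^ m * PowerSeries.coeff m x‖ ^ 2 + (2 * C * ε n + ε n ^ 2) := by
      intro k
      have hzk : ‖z k‖ < 1 := by rw [hz]; exact hr1
      have hXe : ∑ m ∈ Finset.range n, z k ^ m * PowerSeries.coeff m x =
          ∑ m ∈ Finset.range N, z k ^ m * PowerSeries.coeff m x := by
        symm
        refine Finset.sum_subset (Finset.range_mono (by omega)) fun m _ hm => ?_
        rw [hx m (by simpa using hm), mul_zero]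
      rw [hXe]
      set Xz := ∑ m ∈ Finset.range N, z k ^ m * PowerSeries.coeff m x with hXz
      have hXC : ‖Xz‖ ≤ C := by
        refine (norm_sum_le _ _).trans (Finset.sum_le_sum fun m _ => ?_)
        rw [norm_mul, norm_pow]
        exact mul_le_of_le_one_left (norm_nonneg _) (pow_le_one₀ (norm_nonneg _) hzk.le)
      have hYs := hev (z k) hzk
      have hY := (twist ha hzk Xz).2
      rw [← hYs.tsum_eq, ← hYs.summable.sum_add_tsum_nat_add n] at hY
      have htail : ‖∑' i, z k ^ (i + n) * y (i + n)‖ ≤ ε n := by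
        refine tsum_of_norm_bounded
          ((summable_nat_add_iff n).2 hs).hasSum fun i => ?_
        rw [norm_mul, norm_pow, hz]
      have h2 : ‖∑ m ∈ Finset.range n, z k ^ m * y m‖ ≤ ‖Xz‖ + ε n := by
        have h3 := norm_sub_le (∑ m ∈ Finset.range n, z k ^ m * y m +
          ∑' i, z k ^ (i + n) * y (i + n)) (∑' i, z k ^ (i + n) * y (i + n))
        rw [add_sub_cancel_right] at h3
        exact h3.trans (add_le_add hY htail)
      have h4 := pow_le_pow_left₀ (norm_nonneg _) h2 2
      have h5 := mul_le_mul_of_nonneg_right hXC (hε0 n)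
      nlinarith
    have h2 := Finset.sum_le_sum fun k (_ : k ∈ Finset.range n) => h1 k
    rw [Finset.sum_add_distrib, hP, hP] at h2
    simp only [Finset.sum_const, Finset.card_range, nsmul_eq_mul] at h2
    rw [← mul_add] at h2
    have hn0 : (0 : ℝ) < n := by exact_mod_cast (by omega : 0 < n)
    have h3 := le_of_mul_le_mul_left h2 hn0
    have h4 : ∑ m ∈ Finset.range n, (r ^ m * ‖PowerSeries.coeff m x‖) ^ 2 =
        ∑ m ∈ Finset.range N, (r ^ m * ‖PowerSeries.coeff m x‖) ^ 2 := by
      symm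
      refine Finset.sum_subset (Finset.range_mono (by omega)) fun m _ hm => ?_
      rw [hx m (by simpa using hm)]; simp
    rw [h4] at h3
    refine le_trans ?_ h3
    exact Finset.sum_le_sum_of_subset_of_nonneg (Finset.range_mono (by omega))
      fun _ _ _ => by positivity
  have hlim := ((hεt.const_mul (2 * C)).add (hεt.pow 2)).const_add
    (∑ m ∈ Finset.range N, (r ^ m * ‖PowerSeries.coeff m x‖) ^ 2)
  have := ge_of_tendsto hlim (Filter.eventually_atTop.2 ⟨N + 1, hfin⟩)
  simpa using this

lemma RC_self {a : ℕ → H} (ha : SelfMap a) : RC (PowerSeries.mk a) := by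
  intro N x
  rw [← SN_tr_mul, ← SN_tr N x]
  have hx : ∀ m, N ≤ m → PowerSeries.coeff m (tr N x) = 0 := fun m hm => by
    rw [coeff_tr, if_neg (by omega)]
  have hlim : ∀ w : PowerSeries H, Filter.Tendsto
      (fun r : ℝ => ∑ m ∈ Finset.range N, (r ^ m * ‖PowerSeries.coeff m w‖) ^ 2)
      (nhdsWithin 1 (Set.Iio 1)) (nhds (SN N w)) := by
    intro w
    have hc : Continuous fun r : ℝ => ∑ m ∈ Finset.range N, (r ^ m * ‖PowerSeries.coeff m w‖) ^ 2 := by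
      fun_prop
    have := hc.tendsto 1
    simp only [one_pow, one_mul] at this
    exact this.mono_left nhdsWithin_le_nhds
  refine le_of_tendsto_of_tendsto (hlim _) (hlim _) ?_
  have : Set.Ioo (0 : ℝ) 1 ∈ nhdsWithin (1 : ℝ) (Set.Iio 1) := Ioo_mem_nhdsLT one_pos
  filter_upwards [this] with r hr
  exact RC_r ha N _ hx hr.1.le hr.2

/-- Quaternionic Goluzin estimate: for a slice regular self-map `f` of `𝔹`
with `f(0) = 0` and `∂_C f(0) = a₁`, for every `q₀ ∈ 𝔹`,
`|f^h(q₀)| ≤ (|a₁| + 2|q₀|/(1+|q₀|²)) / (1 + |a₁|·2|q₀|/(1+|q₀|²))`. -/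
theorem goluzin_estimate (a : ℕ → H) (ha : SelfMap a) (h0 : evalC a 0 = 0)
    (q₀ : H) (hq₀ : ‖q₀‖ < 1) :
    ‖evalC (hdqC a q₀) q₀‖ ≤
      (‖a 1‖ + 2 * ‖q₀‖ / (1 + ‖q₀‖ ^ 2)) /
        (1 + ‖a 1‖ * (2 * ‖q₀‖ / (1 + ‖q₀‖ ^ 2))) := by
  have ha0 : a 0 = 0 := by
    have h : evalC a 0 = a 0 := by
      unfold evalC
      rw [tsum_eq_single 0 (fun m hm => by simp [hm])]
      simp
    rw [← h, h0]
  have hA : LC (PowerSeries.mk a) := LC_of_RC (RC_self ha)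
  have hG : LC (PowerSeries.mk fun m => a (m + 1)) := by
    refine LC_shift hA ?_
    ext1 m
    rcases m with _ | m
    · simp [ha0]
    · rw [PowerSeries.coeff_succ_X_mul]; simp
  have hh := hdq_LC hA ha0 hq₀ (ha.2 q₀ hq₀)
  obtain ⟨-, h1⟩ := SP hG hq₀
  obtain ⟨h2, h3⟩ := SP hh hq₀
  have e : hdqC a q₀ 0 = evalC (fun m => a (m + 1)) q₀ := by
    simp [hdqC, starMulC, oneMinusQPbarC, diffQuotC, starInvC, ha0, evalC]
  rw [e] at h3
  simp only [zero_add] at h1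
  set s := ‖evalC (fun m => a (m + 1)) q₀‖
  set β := ‖evalC (hdqC a q₀) q₀‖
  set r := ‖q₀‖
  set α := ‖a 1‖
  have hr : 0 ≤ r := norm_nonneg _
  have hα : 0 ≤ α := norm_nonneg _
  have hβ : 0 ≤ β := norm_nonneg _
  have h4 : 0 ≤ 1 - β * r := by nlinarith
  have h5 : β * (1 + 2 * α * r + r ^ 2) ≤ α + 2 * r + α * r ^ 2 := by
    have h6 := mul_le_mul_of_nonneg_right h1 h4
    have h7 : 0 ≤ 1 + α * r := by positivity
    have h8 : β - r ≤ s * (1 - β * r) := by linarith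
    have h9 := mul_le_mul_of_nonneg_right h8 h7
    linarith
  have e2 : (α + 2 * r / (1 + r ^ 2)) / (1 + α * (2 * r / (1 + r ^ 2))) =
      (α + 2 * r + α * r ^ 2) / (1 + 2 * α * r + r ^ 2) := by
    have : 0 < 1 + r ^ 2 := by positivity
    have : 0 < 1 + 2 * α * r + r ^ 2 := by positivity
    have : 0 < 1 + r ^ 2 + α * (2 * r) := by positivity
    field_simp
    ring
  rw [e2, le_div_iff₀ (by positivity)]
  exact h5

end QPaper
end
end

section
/- Let 0 ≤ α < 1 and let f be a slice regular self-map of 𝔹 with f(0) = 0 and first power-series coefficient a₁ = ∂_C f(0) = α. Then for every q ∈ 𝔹: |f^h(q) − α| ≤ (2|q|/(1 + |q|²))·|1 − α f^h(q)|, and (α|q|² − 2|q| + α)/(|q|² − 2α|q| + 1) ≤ Re f^h(q) ≤ |f^h(q)| ≤ (α|q|² + 2|q| + α)/(|q|² + 2α|q| + 1). The same inequalities hold with f^h(q) replaced by f⋆_q(q̄). -/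
noncomputable section

namespace QPaper

set_option linter.unusedSectionVars false

/-! ### `H` as a complex vector space by left multiplication -/

theorem norm_ofC (z : ℂ) : ‖Quaternion.ofComplex z‖ = ‖z‖ := by
  have h : ‖Quaternion.ofComplex z‖ ^ 2 = ‖z‖ ^ 2 := by
    rw [pow_two, ← Quaternion.normSq_eq_norm_mul_self, ← Complex.normSq_eq_norm_sq,
      Quaternion.normSq_def', Complex.normSq_apply]
    rw [show Quaternion.ofComplex z = Quaternion.coeComplex z from rfl]
    simp
    ring
  exact (sq_eq_sq₀ (norm_nonneg _) (norm_nonneg _)).1 h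

def E : Type := H

instance : NormedAddCommGroup E := inferInstanceAs (NormedAddCommGroup H)
instance : CompleteSpace E := inferInstanceAs (CompleteSpace H)
instance : Module ℂ E :=
  { smul := fun z x => (Quaternion.ofComplex z * (show H from x) : H)
    one_smul := fun x => (by rw [map_one, one_mul] : Quaternion.ofComplex 1 * (show H from x) = x)
    mul_smul := fun z w x => (by rw [map_mul, mul_assoc] :
      Quaternion.ofComplex (z * w) * (show H from x) = Quaternion.ofComplex z * (Quaternion.ofComplex w * (show H from x)))
    smul_zero := fun z => (mul_zero (Quaternion.ofComplex z) : Quaternion.ofComplex z * (0 : H) = 0)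
    smul_add := fun z x y => (mul_add (Quaternion.ofComplex z) (show H from x) (show H from y))
    add_smul := fun z w x => (by rw [map_add, add_mul] :
      Quaternion.ofComplex (z + w) * (show H from x) = Quaternion.ofComplex z * (show H from x) + Quaternion.ofComplex w * (show H from x))
    zero_smul := fun x => (by rw [map_zero, zero_mul] : Quaternion.ofComplex 0 * (show H from x) = 0) }

def toE (x : H) : E := x
def ofE (x : E) : H := x

@[simp] theorem ofE_toE (x : H) : ofE (toE x) = x := rfl
@[simp] theorem toE_ofE (x : E) : toE (ofE x) = x := rfl
@[simp] theorem ofE_add (x y : E) : ofE (x + y) = ofE x + ofE y := rfl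
@[simp] theorem ofE_sub (x y : E) : ofE (x - y) = ofE x - ofE y := rfl
@[simp] theorem ofE_smul (z : ℂ) (x : E) : ofE (z • x) = Quaternion.ofComplex z * ofE x := rfl
@[simp] theorem toE_add (x y : H) : toE (x + y) = toE x + toE y := rfl
@[simp] theorem toE_sub (x y : H) : toE (x - y) = toE x - toE y := rfl
theorem norm_ofE (x : E) : ‖ofE x‖ = ‖x‖ := rfl
theorem norm_toE (x : H) : ‖toE x‖ = ‖x‖ := rfl
theorem ofE_inj {x y : E} (h : ofE x = ofE y) : x = y := h
theorem continuous_ofE : Continuous ofE := continuous_id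
def ofEHom : E →+ H := ⟨⟨ofE, rfl⟩, fun _ _ => rfl⟩

instance : NormedSpace ℂ E where
  norm_smul_le z x := by rw [← norm_ofE, ofE_smul, norm_mul, norm_ofC, norm_ofE]

abbrev Op : Type := E →L[ℂ] E

/-- Right multiplication operator. -/
def rmul (c : H) : Op :=
  LinearMap.mkContinuous
    { toFun := fun x => toE (ofE x * c)
      map_add' := fun x y => by simp [add_mul]
      map_smul' := fun z x => by apply ofE_inj; simp [mul_assoc] } ‖c‖
    (fun x => by simp [norm_toE, norm_ofE, mul_comm])

@[simp] theorem rmul_apply (c : H) (x : E) : rmul c x = toE (ofE x * c) := rfl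

theorem rmul_norm_le (c : H) : ‖rmul c‖ ≤ ‖c‖ :=
  LinearMap.mkContinuous_norm_le _ (norm_nonneg _) _

theorem rmul_norm (c : H) : ‖rmul c‖ = ‖c‖ := by
  refine le_antisymm (rmul_norm_le c) ?_
  have := (rmul c).le_opNorm (toE 1)
  simpa [norm_toE] using this

theorem rmul_mul (c d : H) : rmul (c * d) = rmul d * rmul c := by
  ext1 x; simp [mul_assoc]

theorem rmul_add (c d : H) : rmul (c + d) = rmul c + rmul d := by
  ext1 x; simp [mul_add]

theorem rmul_sub (c d : H) : rmul (c - d) = rmul c - rmul d := by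
  ext1 x; simp [mul_sub]

theorem rmul_one : rmul 1 = 1 := by ext1 x; simp

theorem rmul_zero : rmul 0 = 0 := by ext1 x; apply ofE_inj; simp; rfl

theorem rmul_sum {ι : Type*} (s : Finset ι) (g : ι → H) :
    rmul (∑ i ∈ s, g i) = ∑ i ∈ s, rmul (g i) := by
  classical
  induction s using Finset.induction_on with
  | empty => simp [rmul_zero]
  | insert i s hi ih => rw [Finset.sum_insert hi, Finset.sum_insert hi, rmul_add, ih]

/-! ### Power series with values in a normed space -/

section generic

variable {V : Type*} [NormedAddCommGroup V]

def Adm (c : ℕ → V) : Prop := ∀ r : ℝ, 0 ≤ r → r < 1 → Summable fun n => ‖c n‖ * r ^ n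

theorem adm_of_bdd (c : ℕ → V)
    (h : ∀ r : ℝ, 0 < r → r < 1 → ∃ s K : ℝ, r ≤ s ∧ ∀ n, ‖c n‖ * s ^ n ≤ K) : Adm c := by
  intro r hr0 hr1
  obtain ⟨t, hrt, ht1⟩ := exists_between hr1
  have ht0 : 0 < t := lt_of_le_of_lt hr0 hrt
  obtain ⟨s, K, hts, hK⟩ := h t ht0 ht1
  have hs : Summable fun n : ℕ => K * (r / t) ^ n :=
    (summable_geometric_of_lt_one (by positivity) ((div_lt_one ht0).2 hrt)).mul_left K
  refine Summable.of_nonneg_of_le (fun n => by positivity) (fun n => ?_) hs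
  have h1 : ‖c n‖ * t ^ n ≤ K :=
    le_trans (by gcongr) (hK n)
  have h2 : ‖c n‖ * r ^ n = ‖c n‖ * t ^ n * (r / t) ^ n := by
    rw [div_pow]; field_simp
  rw [h2]
  gcongr

variable [NormedSpace ℂ V]

theorem adm_of_summable (c : ℕ → V)
    (h : ∀ r : ℝ, 0 < r → r < 1 → Summable fun n => (r : ℂ) ^ n • c n) : Adm c := by
  refine adm_of_bdd c fun r hr0 hr1 => ?_
  have h1 := (h r hr0 hr1).tendsto_atTop_zero.norm
  obtain ⟨K, hK⟩ := h1.bddAbove_range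
  refine ⟨r, K, le_rfl, fun n => ?_⟩
  have := hK ⟨n, rfl⟩
  simpa [norm_smul, abs_of_pos hr0, mul_comm] using this

def pf (c : ℕ → V) (z : ℂ) : V := ∑' n, z ^ n • c n

theorem Adm.snorm {c : ℕ → V} (h : Adm c) {z : ℂ} (hz : ‖z‖ < 1) :
    Summable fun n => ‖z ^ n • c n‖ := by
  have := h ‖z‖ (norm_nonneg _) hz
  simpa [norm_smul, mul_comm] using this

variable [CompleteSpace V]

theorem Adm.hasSum {c : ℕ → V} (h : Adm c) {z : ℂ} (hz : ‖z‖ < 1) :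
    HasSum (fun n => z ^ n • c n) (pf c z) := (h.snorm hz).of_norm.hasSum

theorem Adm.diff {c : ℕ → V} (h : Adm c) : DifferentiableOn ℂ (pf c) (Metric.ball 0 1) := by
  intro z hz
  rw [mem_ball_zero_iff] at hz
  obtain ⟨r, hzr, hr1⟩ := exists_between hz
  have hr0 : 0 ≤ r := (norm_nonneg z).trans hzr.le
  have := Complex.differentiableOn_tsum_of_summable_norm (F := fun n (w : ℂ) => w ^ n • c n)
    (U := Metric.ball (0 : ℂ) r) (h r hr0 hr1)
    (fun n => by fun_prop) Metric.isOpen_ball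
    (fun n w hw => by
      rw [mem_ball_zero_iff] at hw
      rw [norm_smul, norm_pow, mul_comm]
      gcongr)
  exact (this.differentiableAt (Metric.isOpen_ball.mem_nhds (by simpa using hzr))).differentiableWithinAt

theorem taylor {f : ℂ → V} (hf : DifferentiableOn ℂ f (Metric.ball 0 1)) :
    ∃ c : ℕ → V, Adm c ∧ ∀ z : ℂ, ‖z‖ < 1 → pf c z = f z := by
  refine ⟨fun n => ((n.factorial : ℂ))⁻¹ • iteratedDeriv n f 0, ?_, ?_⟩
  · refine adm_of_summable _ fun r hr0 hr1 => ?_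
    have := Complex.hasSum_taylorSeries_on_ball hf (z := (r : ℂ))
      (by simpa [abs_of_pos hr0] using hr1)
    refine this.summable.congr fun n => ?_
    rw [sub_zero, smul_comm]
  · intro z hz
    have := Complex.hasSum_taylorSeries_on_ball hf (z := z) (by simpa using hz)
    rw [← this.tsum_eq]
    refine tsum_congr fun n => ?_
    rw [sub_zero, smul_comm]

def mkps (e : ℕ → V) : FormalMultilinearSeries ℂ ℂ V :=
  fun n => ContinuousMultilinearMap.mkPiRing ℂ (Fin n) (e n)

theorem mkps_coeff (e : ℕ → V) (n : ℕ) : (mkps e).coeff n = e n := by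
  simp [FormalMultilinearSeries.coeff, mkps]

theorem pf_unique {c d : ℕ → V} (hc : Adm c) (hd : Adm d)
    (h : ∀ z : ℂ, ‖z‖ < 1 → pf c z = pf d z) : c = d := by
  have key : ∀ e : ℕ → V, Adm e → (∀ z : ℂ, ‖z‖ < 1 → pf c z = pf e z) →
      HasFPowerSeriesAt (pf c) (mkps e) 0 := by
    intro e he h'
    rw [hasFPowerSeriesAt_iff]
    filter_upwards [Metric.ball_mem_nhds (0 : ℂ) one_pos] with z hz
    rw [mem_ball_zero_iff] at hz
    rw [zero_add, h' z hz]
    simpa only [mkps_coeff] using he.hasSum hz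
  have := (key c hc fun _ _ => rfl).eq_formalMultilinearSeries (key d hd h)
  funext n
  have h2 := congrArg (fun p : FormalMultilinearSeries ℂ ℂ V => p.coeff n) this
  simpa only [mkps_coeff] using h2

end generic

section ring

variable {A : Type*} [NormedRing A] [NormedAlgebra ℂ A] [CompleteSpace A]

def cauchy (c d : ℕ → A) : ℕ → A := fun n => ∑ kl ∈ Finset.HasAntidiagonal.antidiagonal n, c kl.1 * d kl.2

theorem cauchy_term (c d : ℕ → A) (z : ℂ) (n : ℕ) :
    ∑ kl ∈ Finset.HasAntidiagonal.antidiagonal n, (z ^ kl.1 • c kl.1) * (z ^ kl.2 • d kl.2)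
      = z ^ n • cauchy c d n := by
  rw [cauchy, Finset.smul_sum]
  refine Finset.sum_congr rfl fun kl hkl => ?_
  rw [smul_mul_smul_comm, ← pow_add, Finset.HasAntidiagonal.mem_antidiagonal.1 hkl]

theorem cauchy_adm {c d : ℕ → A} (hc : Adm c) (hd : Adm d) : Adm (cauchy c d) := by
  refine adm_of_summable _ fun r hr0 hr1 => ?_
  have hr : ‖(r : ℂ)‖ < 1 := by simpa [abs_of_pos hr0] using hr1
  have := (summable_norm_sum_mul_antidiagonal_of_summable_norm (hc.snorm hr) (hd.snorm hr)).of_norm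
  exact this.congr fun n => cauchy_term c d _ n

theorem cauchy_pf {c d : ℕ → A} (hc : Adm c) (hd : Adm d) {z : ℂ} (hz : ‖z‖ < 1) :
    pf (cauchy c d) z = pf c z * pf d z := by
  rw [pf, pf, pf, tsum_mul_tsum_eq_tsum_sum_antidiagonal_of_summable_norm (hc.snorm hz) (hd.snorm hz)]
  exact tsum_congr fun n => (cauchy_term c d z n).symm

end ring

theorem adm_rmul {a : ℕ → H} (h : Adm a) : Adm fun n => rmul (a n) := by
  intro r h0 h1
  simpa only [rmul_norm] using h r h0 h1

theorem adm_of_rmul {a : ℕ → H} (h : Adm fun n => rmul (a n)) : Adm a := by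
  intro r h0 h1
  simpa only [rmul_norm] using h r h0 h1

def Phi (a : ℕ → H) (z : ℂ) : Op := pf (fun n => rmul (a n)) z

def act (a : ℕ → H) (z : ℂ) (x : H) : H := ofE (Phi a z (toE x))

theorem act_add (a : ℕ → H) (z : ℂ) (x y : H) : act a z (x + y) = act a z x + act a z y := by
  simp [act]

theorem act_sub (a : ℕ → H) (z : ℂ) (x y : H) : act a z (x - y) = act a z x - act a z y := by
  simp [act]

theorem act_smul (a : ℕ → H) (z w : ℂ) (x : H) :
    act a z (Quaternion.ofComplex w * x) = Quaternion.ofComplex w * act a z x := by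
  have : toE (Quaternion.ofComplex w * x) = w • toE x := rfl
  rw [act, this, map_smul, ofE_smul, act]

theorem norm_act_le (a : ℕ → H) (z : ℂ) (x : H) : ‖act a z x‖ ≤ ‖Phi a z‖ * ‖x‖ :=
  (Phi a z).le_opNorm (toE x)

theorem act_hasSum {a : ℕ → H} (h : Adm a) {z : ℂ} (hz : ‖z‖ < 1) (x : H) :
    HasSum (fun n => (Quaternion.ofComplex z) ^ n * (x * a n)) (act a z x) := by
  have h1 := (adm_rmul h).hasSum hz
  have h2 := h1.mapL (ContinuousLinearMap.apply ℂ E (toE x))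
  have h3 := h2.map ofEHom continuous_ofE
  refine (congrArg (fun f => HasSum f _) (funext fun n => ?_)).mp h3
  simp only [← map_pow]
  rfl

def Schur (a : ℕ → H) : Prop := Adm a ∧ ∀ z : ℂ, ‖z‖ < 1 → ‖Phi a z‖ ≤ 1

theorem Schur.act_le {a : ℕ → H} (h : Schur a) {z : ℂ} (hz : ‖z‖ < 1) (x : H) :
    ‖act a z x‖ ≤ ‖x‖ :=
  (norm_act_le a z x).trans (by simpa using mul_le_mul_of_nonneg_right (h.2 z hz) (norm_nonneg x))

theorem act_eval {a : ℕ → H} (h : Adm a) {z : ℂ} (hz : ‖z‖ < 1) {x q : H} (hx : x ≠ 0)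
    (hq : Quaternion.ofComplex z * x = x * q) : act a z x = x * evalC a q := by
  have hp : ∀ n : ℕ, Quaternion.ofComplex z ^ n * x = x * q ^ n := by
    intro n
    induction n with
    | zero => simp
    | succ n ih => rw [pow_succ, mul_assoc, hq, ← mul_assoc, ih, mul_assoc, ← pow_succ]
  have h1 := (act_hasSum h hz x).mul_left x⁻¹
  have h2 : HasSum (fun n => q ^ n * a n) (x⁻¹ * act a z x) := by
    refine (congrArg (fun f => HasSum f _) (funext fun n => ?_)).mp h1
    rw [← mul_assoc (_ ^ n), hp, mul_assoc, inv_mul_cancel_left₀ hx]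
  rw [evalC, h2.tsum_eq, mul_inv_cancel_left₀ hx]

theorem mkQ (a b c d : ℝ) : ∃ x : H, x.re = a ∧ x.imI = b ∧ x.imJ = c ∧ x.imK = d :=
  ⟨⟨a, b, c, d⟩, rfl, rfl, rfl, rfl⟩

theorem exists_conj (q : H) : ∃ (z : ℂ) (x : H), x ≠ 0 ∧ Quaternion.ofComplex z * x = x * q ∧
    ‖z‖ = ‖q‖ := by
  suffices h : ∃ (z : ℂ) (x : H), x ≠ 0 ∧ Quaternion.ofComplex z * x = x * q by
    obtain ⟨z, x, hx, h⟩ := h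
    refine ⟨z, x, hx, h, ?_⟩
    have := congrArg norm h
    rw [norm_mul, norm_mul, norm_ofC, mul_comm] at this
    exact mul_left_cancel₀ (norm_ne_zero_iff.2 hx) this
  set y : ℝ := Real.sqrt (q.imI ^ 2 + q.imJ ^ 2 + q.imK ^ 2) with hy
  have hyy : y * y = q.imI ^ 2 + q.imJ ^ 2 + q.imK ^ 2 := Real.mul_self_sqrt (by positivity)
  obtain ⟨hz1, hz2, hz3, hz4⟩ : (Quaternion.ofComplex ⟨q.re, y⟩).re = q.re ∧
      (Quaternion.ofComplex ⟨q.re, y⟩).imI = y ∧ (Quaternion.ofComplex ⟨q.re, y⟩).imJ = 0 ∧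
      (Quaternion.ofComplex ⟨q.re, y⟩).imK = 0 := ⟨rfl, rfl, rfl, rfl⟩
  by_cases hc : y + q.imI = 0 ∧ q.imJ = 0 ∧ q.imK = 0
  · obtain ⟨h1, h2, h3⟩ := hc
    obtain ⟨x, x1, x2, x3, x4⟩ := mkQ 0 0 1 0
    refine ⟨⟨q.re, y⟩, x, ?_, ?_⟩
    · rintro rfl
      have : (0 : ℝ) = 1 := x3
      norm_num at this
    · have : q.imI = -y := by linarith
      apply Quaternion.ext <;>
        simp only [Quaternion.re_mul, Quaternion.imI_mul, Quaternion.imJ_mul, Quaternion.imK_mul,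
          hz1, hz2, hz3, hz4, x1, x2, x3, x4, this, h2, h3] <;> ring
  · obtain ⟨x, x1, x2, x3, x4⟩ := mkQ (y + q.imI) 0 q.imK (-q.imJ)
    refine ⟨⟨q.re, y⟩, x, ?_, ?_⟩
    · rintro rfl
      apply hc
      refine ⟨x1.symm, ?_, x3.symm⟩
      have : (0 : ℝ) = -q.imJ := x4
      linarith
    · apply Quaternion.ext <;>
        simp only [Quaternion.re_mul, Quaternion.imI_mul, Quaternion.imJ_mul, Quaternion.imK_mul,
          hz1, hz2, hz3, hz4, x1, x2, x3, x4] <;> nlinarith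

theorem adm_of_summableOn {a : ℕ → H} (h : SummableOn a) : Adm a := by
  refine adm_of_bdd a fun r hr0 hr1 => ?_
  have h1 := (h (r : H) (by simpa [abs_of_pos hr0] using hr1)).tendsto_atTop_zero.norm
  obtain ⟨K, hK⟩ := h1.bddAbove_range
  refine ⟨r, K, le_rfl, fun n => ?_⟩
  have := hK ⟨n, rfl⟩
  simpa [abs_of_pos hr0, mul_comm] using this

theorem Adm.hasSum_eval {a : ℕ → H} (h : Adm a) {q : H} (hq : ‖q‖ < 1) :
    HasSum (fun n => q ^ n * a n) (evalC a q) := by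
  refine Summable.hasSum (Summable.of_norm ?_)
  simpa [mul_comm] using h ‖q‖ (norm_nonneg _) hq

theorem SelfMap.schur {a : ℕ → H} (h : SelfMap a) : Schur a := by
  have ha := adm_of_summableOn h.1
  refine ⟨ha, fun z hz => ?_⟩
  refine ContinuousLinearMap.opNorm_le_bound _ zero_le_one fun x => ?_
  change ‖act a z (ofE x)‖ ≤ 1 * ‖ofE x‖
  generalize ofE x = x
  by_cases hx : x = 0
  · subst hx; simpa using norm_act_le a z 0
  · have hq : Quaternion.ofComplex z * x = x * (x⁻¹ * Quaternion.ofComplex z * x) := by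
      rw [mul_assoc, mul_inv_cancel_left₀ hx]
    rw [act_eval ha hz hx hq, norm_mul, mul_comm]
    gcongr
    refine (h.2 _ ?_).le
    rw [norm_mul, norm_mul, norm_inv, norm_ofC]
    have := norm_ne_zero_iff.2 hx
    field_simp
    exact hz

theorem Schur.eval_le {a : ℕ → H} (h : Schur a) {q : H} (hq : ‖q‖ < 1) : ‖evalC a q‖ ≤ 1 := by
  obtain ⟨z, x, hx, hzx, hz⟩ := exists_conj q
  have h1 := h.act_le (hz ▸ hq) x
  rw [act_eval h.1 (hz ▸ hq) hx hzx, norm_mul] at h1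
  have := norm_pos_iff.2 hx
  nlinarith

theorem dq_bound {a : ℕ → H} (h : Adm a) {p : H} {s : ℝ} (hs0 : 0 < s) (hs1 : s < 1)
    (hps : ‖p‖ ≤ s) (m : ℕ) :
    (Summable fun k => ‖p ^ k * a (k + m + 1)‖) ∧
      ‖diffQuotC a p m‖ * s ^ m ≤ (∑' n, ‖a n‖ * s ^ n) / s := by
  have hS := h s hs0.le hs1
  have hinj : Function.Injective fun k : ℕ => k + (m + 1) := fun x y hxy => by
    simpa using hxy
  have hS2 : Summable fun k : ℕ => ‖a (k + (m + 1))‖ * s ^ (k + (m + 1)) :=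
    hS.comp_injective hinj
  have hle := tsum_comp_le_tsum_of_inj hS (fun n => by positivity) hinj
  have hS3 := hS2.mul_left (s ^ (m + 1))⁻¹
  have hb : ∀ k : ℕ, ‖p ^ k * a (k + m + 1)‖ ≤
      (s ^ (m + 1))⁻¹ * (‖a (k + (m + 1))‖ * s ^ (k + (m + 1))) := by
    intro k
    have e : (s ^ (m + 1))⁻¹ * (‖a (k + (m + 1))‖ * s ^ (k + (m + 1)))
        = s ^ k * ‖a (k + m + 1)‖ := by
      rw [pow_add s k, add_assoc]; field_simp
    rw [e, norm_mul, norm_pow]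
    gcongr
  have hsum := Summable.of_nonneg_of_le (fun k => norm_nonneg _) hb hS3
  refine ⟨hsum, ?_⟩
  have h1 : ‖diffQuotC a p m‖ ≤ (s ^ (m + 1))⁻¹ * ∑' n, ‖a n‖ * s ^ n := by
    refine (tsum_of_norm_bounded hS3.hasSum hb).trans ?_
    rw [tsum_mul_left]
    exact mul_le_mul_of_nonneg_left hle (by positivity)
  calc ‖diffQuotC a p m‖ * s ^ m ≤ (s ^ (m + 1))⁻¹ * (∑' n, ‖a n‖ * s ^ n) * s ^ m := by gcongr
    _ = _ := by rw [pow_succ]; field_simp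

theorem dq_summable {a : ℕ → H} (h : Adm a) {p : H} (hp : ‖p‖ < 1) (m : ℕ) :
    Summable fun k => p ^ k * a (k + m + 1) := by
  obtain ⟨s, hs, hs1⟩ := exists_between hp
  exact (dq_bound h (lt_of_le_of_lt (norm_nonneg p) hs) hs1 hs.le m).1.of_norm

theorem dq_adm {a : ℕ → H} (h : Adm a) {p : H} (hp : ‖p‖ < 1) : Adm (diffQuotC a p) := by
  refine adm_of_bdd _ fun r hr0 hr1 => ?_
  exact ⟨max r ‖p‖, _, le_max_left _ _, fun n =>
    (dq_bound h (lt_of_lt_of_le hr0 (le_max_left _ _)) (max_lt hr1 hp) (le_max_right _ _) n).2⟩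

theorem dq_succ {a : ℕ → H} (h : Adm a) {p : H} (hp : ‖p‖ < 1) (m : ℕ) :
    diffQuotC a p m = a (m + 1) + p * diffQuotC a p (m + 1) := by
  rw [diffQuotC, (dq_summable h hp m).tsum_eq_zero_add, diffQuotC,
    ← (dq_summable h hp (m + 1)).tsum_mul_left]
  congr 1
  · simp
  · refine tsum_congr fun k => ?_
    rw [pow_succ', mul_assoc, show k + 1 + m + 1 = k + (m + 1) + 1 by ring]

theorem dq_zero {a : ℕ → H} (h : Adm a) {p : H} (hp : ‖p‖ < 1) :
    evalC a p = a 0 + p * diffQuotC a p 0 := by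
  rw [evalC, (h.hasSum_eval hp).summable.tsum_eq_zero_add, diffQuotC,
    ← (dq_summable h hp 0).tsum_mul_left]
  congr 1
  · simp
  · refine tsum_congr fun k => ?_
    rw [pow_succ', mul_assoc, add_zero]

theorem act_dq {a : ℕ → H} (h : Adm a) {p : H} (hp : ‖p‖ < 1) {z : ℂ} (hz : ‖z‖ < 1) (x : H) :
    act (diffQuotC a p) z (Quaternion.ofComplex z * x - x * p) = act a z x - x * evalC a p := by
  rw [act_sub, act_smul]
  have hT := act_hasSum (dq_adm h hp) hz x
  have hS := act_hasSum (dq_adm h hp) hz (x * p)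
  have hU := act_hasSum h hz x
  have hS' := (hasSum_nat_add_iff' 1).2 hS
  have hU' := (hasSum_nat_add_iff' 1).2 hU
  have hV := (hT.mul_left (Quaternion.ofComplex z)).sub hU'
  have e : (fun n => Quaternion.ofComplex z ^ (n + 1) * (x * p * diffQuotC a p (n + 1))) =
      fun n => Quaternion.ofComplex z * (Quaternion.ofComplex z ^ n * (x * diffQuotC a p n))
        - Quaternion.ofComplex z ^ (n + 1) * (x * a (n + 1)) := by
    funext n
    rw [dq_succ h hp n, pow_succ']
    noncomm_ring
  rw [e] at hS'
  have := hS'.unique hV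
  simp only [Finset.range_one, Finset.sum_singleton, pow_zero, one_mul] at this
  rw [dq_zero h hp]
  rw [sub_eq_iff_eq_add] at this
  rw [this]
  noncomm_ring

/-! ### star products and operator Cauchy products -/

theorem rmul_starMul (a b : ℕ → H) :
    (fun n => rmul (starMulC a b n)) = cauchy (fun n => rmul (b n)) (fun n => rmul (a n)) := by
  funext n
  rw [cauchy, Finset.Nat.sum_antidiagonal_eq_sum_range_succ (fun i j => rmul (b i) * rmul (a j)),
    starMulC, rmul_sum]
  exact Finset.sum_congr rfl fun i _ => rmul_mul _ _

theorem starInv_right {a : ℕ → H} (h : a 0 ≠ 0) :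
    starMulC a (starInvC a) = fun n => if n = 0 then 1 else 0 := by
  funext n
  cases n with
  | zero => simp [starMulC, starInvC, h]
  | succ m =>
    rw [starMulC, Finset.sum_range_succ, starInvC, Finset.sum_range]
    simp [h]

theorem mk_cauchy {A : Type*} [NormedRing A] (c d : ℕ → A) :
    PowerSeries.mk (cauchy c d) = PowerSeries.mk c * PowerSeries.mk d := by
  ext n
  simp [PowerSeries.coeff_mul, cauchy]

theorem cancel_inv {d n : ℕ → H} {C : ℕ → Op} (hd : d 0 ≠ 0)
    (h : cauchy (fun k => rmul (d k)) C = fun k => rmul (n k)) :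
    C = fun k => rmul (starMulC n (starInvC d) k) := by
  have h1 : cauchy (fun k => rmul (starInvC d k)) (fun k => rmul (d k))
      = fun n => if n = 0 then 1 else 0 := by
    rw [← rmul_starMul, starInv_right hd]
    funext n
    by_cases hn : n = 0
    · simp [hn, rmul_one]
    · simp [hn, rmul_zero]
  have h2 : PowerSeries.mk (fun n : ℕ => if n = 0 then (1 : Op) else 0) = 1 := by
    ext n
    simp [PowerSeries.coeff_one]
  have h3 : PowerSeries.mk C = PowerSeries.mk (fun k => rmul (starMulC n (starInvC d) k)) := by
    rw [rmul_starMul, mk_cauchy, ← h, mk_cauchy, ← mul_assoc, ← mk_cauchy, h1, h2, one_mul]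
  funext k
  simpa using congrArg (PowerSeries.coeff k) h3

theorem adm_fin {c : ℕ → H} (N : ℕ) (h : ∀ n, N ≤ n → c n = 0) : Adm c := by
  intro r _ _
  refine summable_of_ne_finset_zero (s := Finset.range N) fun n hn => ?_
  rw [h n (by simpa using hn)]; simp

def Dc (a : ℕ → H) (w : H) : ℕ → H := fun m => (if m = 0 then (1 : H) else 0) - star w * a m

theorem Dc_adm {a : ℕ → H} (h : Adm a) (w : H) : Adm (Dc a w) := by
  intro r h0 h1
  have hd : Adm (fun m : ℕ => if m = 0 then (1 : H) else 0) :=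
    adm_fin 1 fun n hn => by rw [if_neg (by omega)]
  refine Summable.of_nonneg_of_le (fun n => by positivity) (fun n => ?_)
    ((hd r h0 h1).add ((h r h0 h1).mul_left ‖w‖))
  rw [← mul_assoc, ← add_mul]
  gcongr
  refine (norm_sub_le _ _).trans ?_
  rw [norm_mul, norm_star]

theorem act_D {a : ℕ → H} (h : Adm a) (w : H) {z : ℂ} (hz : ‖z‖ < 1) (x : H) :
    act (Dc a w) z x = x - act a z (x * star w) := by
  have h1 := act_hasSum (Dc_adm h w) hz x
  have h2 := act_hasSum h hz (x * star w)
  have h3 : HasSum (fun n : ℕ => if n = 0 then x else 0) x := hasSum_ite_eq 0 x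
  refine h1.unique ((congrArg (fun f => HasSum f _) (funext fun n => ?_)).mp (h3.sub h2))
  rw [Dc]
  split_ifs with hn
  · subst hn; noncomm_ring
  · noncomm_ring

theorem Q_adm (p : H) : Adm (oneMinusQPbarC p) :=
  adm_fin 2 fun n hn => by rw [oneMinusQPbarC, if_neg (by omega), if_neg (by omega)]

theorem act_Q (p : H) {z : ℂ} (hz : ‖z‖ < 1) (x : H) :
    act (oneMinusQPbarC p) z x = x - Quaternion.ofComplex z * x * star p := by
  have h1 := act_hasSum (Q_adm p) hz x
  have h2 := hasSum_sum_of_ne_finset_zero (L := SummationFilter.unconditional ℕ)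
    (f := fun n => Quaternion.ofComplex z ^ n * (x * oneMinusQPbarC p n))
    (s := Finset.range 2) (fun n hn => by
      have : 2 ≤ n := by rw [Finset.mem_range, not_lt] at hn; exact hn
      rw [oneMinusQPbarC, if_neg (by omega), if_neg (by omega)]; simp)
  rw [h1.unique h2]
  simp [Finset.sum_range_succ, oneMinusQPbarC]
  noncomm_ring

theorem norm_id1 (v k w : H) : ‖v + k * w‖ ^ 2 - ‖k + v * star w‖ ^ 2
    = (1 - ‖w‖ ^ 2) * (‖v‖ ^ 2 - ‖k‖ ^ 2) := by
  simp only [pow_two, ← Quaternion.normSq_eq_norm_mul_self, Quaternion.normSq_def',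
    Quaternion.re_mul, Quaternion.imI_mul, Quaternion.imJ_mul, Quaternion.imK_mul,
    Quaternion.re_add, Quaternion.imI_add, Quaternion.imJ_add, Quaternion.imK_add,
    Quaternion.re_star, Quaternion.imI_star, Quaternion.imJ_star, Quaternion.imK_star]
  ring

theorem norm_id2 (c x p : H) : ‖x - c * x * star p‖ ^ 2 - ‖c * x - x * p‖ ^ 2
    = (1 - ‖c‖ ^ 2) * (1 - ‖p‖ ^ 2) * ‖x‖ ^ 2 := by
  simp only [pow_two, ← Quaternion.normSq_eq_norm_mul_self, Quaternion.normSq_def',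
    Quaternion.re_mul, Quaternion.imI_mul, Quaternion.imJ_mul, Quaternion.imK_mul,
    Quaternion.re_sub, Quaternion.imI_sub, Quaternion.imJ_sub, Quaternion.imK_sub,
    Quaternion.re_star, Quaternion.imI_star, Quaternion.imJ_star, Quaternion.imK_star]
  ring

theorem sylvester {c p : H} (h : ‖p‖ < ‖c‖) (x : H) : ∃ y : H, c * y - y * p = x := by
  let L : H →ₗ[ℝ] H := LinearMap.mulLeft ℝ c - LinearMap.mulRight ℝ p
  have hi : Function.Injective L := by
    rw [← LinearMap.ker_eq_bot, LinearMap.ker_eq_bot']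
    intro y hy
    have hy' : c * y = y * p := sub_eq_zero.1 hy
    have := congrArg norm hy'
    rw [norm_mul, norm_mul] at this
    by_contra hne
    have := norm_pos_iff.2 hne
    nlinarith
  exact LinearMap.injective_iff_surjective.1 hi x

theorem Phi_norm_le {c : ℕ → H} {z : ℂ} {M : ℝ} (hM : 0 ≤ M) (h : ∀ x, ‖act c z x‖ ≤ M * ‖x‖) :
    ‖Phi c z‖ ≤ M := by
  refine ContinuousLinearMap.opNorm_le_bound _ hM fun y => ?_
  have := h (ofE y)
  rwa [act, toE_ofE, norm_ofE, norm_ofE] at this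

theorem Phi_D {a : ℕ → H} (h : Adm a) (w : H) {z : ℂ} (hz : ‖z‖ < 1) :
    Phi (Dc a w) z = 1 - Phi a z * rmul (star w) := by
  ext y
  have := act_D h w hz (ofE y)
  apply ofE_inj
  rw [act, act, toE_ofE] at this
  exact this

theorem isUnit_D {a : ℕ → H} (h : Schur a) {w : H} (hw : ‖w‖ < 1) {z : ℂ} (hz : ‖z‖ < 1) :
    IsUnit (Phi (Dc a w) z) := by
  rw [Phi_D h.1 w hz]
  apply isUnit_one_sub_of_norm_lt_one
  calc ‖Phi a z * rmul (star w)‖ ≤ ‖Phi a z‖ * ‖rmul (star w)‖ := norm_mul_le _ _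
    _ ≤ 1 * ‖w‖ := by
        rw [← norm_star w]
        exact mul_le_mul (h.2 z hz) (rmul_norm _).le (norm_nonneg _) zero_le_one
    _ < 1 := by rwa [one_mul]

theorem hdq_op {a : ℕ → H} (h : Schur a) {p : H} (hp : ‖p‖ < 1) (hw : ‖evalC a p‖ < 1)
    (ha0 : ‖a 0‖ ≤ 1) :
    Adm (hdqC a p) ∧ ∀ z : ℂ, ‖z‖ < 1 →
      Phi (Dc a (evalC a p)) z * Phi (hdqC a p) z
        = Phi (diffQuotC a p) z * Phi (oneMinusQPbarC p) z := by
  set w := evalC a p with hwdef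
  have aD := adm_rmul (Dc_adm h.1 w)
  have aR := adm_rmul (dq_adm h.1 hp)
  have aQ := adm_rmul (Q_adm p)
  have hG : DifferentiableOn ℂ (fun z => Ring.inverse (Phi (Dc a w) z) *
      (Phi (diffQuotC a p) z * Phi (oneMinusQPbarC p) z)) (Metric.ball 0 1) := by
    refine DifferentiableOn.mul ?_ (aR.diff.mul aQ.diff)
    intro z hz
    have hu := isUnit_D h hw (mem_ball_zero_iff.1 hz)
    exact (differentiableAt_inverse hu).comp_differentiableWithinAt z (aD.diff z hz)
  obtain ⟨C, hC, hCe⟩ := taylor hG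
  have key : ∀ z : ℂ, ‖z‖ < 1 → Phi (Dc a w) z * pf C z
      = Phi (diffQuotC a p) z * Phi (oneMinusQPbarC p) z := by
    intro z hz
    rw [hCe z hz, ← mul_assoc, Ring.mul_inverse_cancel _ (isUnit_D h hw hz), one_mul]
  have e1 : cauchy (fun n => rmul (Dc a w n)) C = fun k => rmul (starMulC (oneMinusQPbarC p)
      (diffQuotC a p) k) := by
    rw [rmul_starMul]
    refine pf_unique (cauchy_adm aD hC) (cauchy_adm aR aQ) fun z hz => ?_
    rw [cauchy_pf aD hC hz, cauchy_pf aR aQ hz]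
    exact key z hz
  have hD0 : Dc a w 0 ≠ 0 := by
    intro h0
    have : star w * a 0 = 1 := by
      simp only [Dc, if_true] at h0
      exact (sub_eq_zero.1 h0).symm
    have := congrArg norm this
    rw [norm_mul, norm_star, norm_one] at this
    nlinarith [norm_nonneg w, norm_nonneg (a 0)]
  have e2 := cancel_inv hD0 e1
  have e3 : C = fun k => rmul (hdqC a p k) := e2
  subst e3
  exact ⟨adm_of_rmul hC, key⟩

theorem hdq_eq {a : ℕ → H} (h : Schur a) {p : H} (hp : ‖p‖ < 1) (hw : ‖evalC a p‖ < 1)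
    (ha0 : ‖a 0‖ ≤ 1) {z : ℂ} (hz : ‖z‖ < 1) (x : H) :
    act (hdqC a p) z x - act a z (act (hdqC a p) z x * star (evalC a p))
      = act (diffQuotC a p) z (x - Quaternion.ofComplex z * x * star p) := by
  rw [← act_D h.1 _ hz, ← act_Q p hz]
  have := congrArg (fun T : Op => ofE (T (toE x))) ((hdq_op h hp hw ha0).2 z hz)
  simpa [act] using this

theorem hdq_bound {a : ℕ → H} (h : Schur a) {p : H} (hp : ‖p‖ < 1) (hw : ‖evalC a p‖ < 1)
    (ha0 : ‖a 0‖ ≤ 1) {z : ℂ} (hz : ‖z‖ < 1) (hpz : ‖p‖ < ‖z‖) :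
    ‖Phi (hdqC a p) z‖ ≤ Real.sqrt (1 + (1 - ‖z‖ ^ 2) / (‖z‖ - ‖p‖) ^ 2) := by
  refine Phi_norm_le (Real.sqrt_nonneg _) fun x => ?_
  set c := Quaternion.ofComplex z with hc
  have hcn : ‖c‖ = ‖z‖ := norm_ofC z
  obtain ⟨l, hl⟩ := sylvester (c := c) (p := p) (by rwa [hcn]) x
  set k := l - c * l * star p with hk
  set v := act (hdqC a p) z x with hv
  have e0 : x - c * x * star p = c * k - k * p := by
    have : p * star p = star p * p := by
      rw [Quaternion.self_mul_star, Quaternion.star_mul_self]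
    rw [hk, ← hl]
    have e : c * l * p * star p = c * l * star p * p := by
      rw [mul_assoc (c * l), this, ← mul_assoc]
    simp only [mul_sub, sub_mul, ← mul_assoc, e]
    abel
  have e1 := hdq_eq h hp hw ha0 hz x
  rw [← hc, e0, act_dq h.1 hp hz, ← hv] at e1
  have e2 : v + k * evalC a p = act a z (k + v * star (evalC a p)) := by
    rw [act_add]
    rw [sub_eq_sub_iff_add_eq_add] at e1
    rw [e1, add_comm]
  have e3 : ‖v + k * evalC a p‖ ≤ ‖k + v * star (evalC a p)‖ := by
    rw [e2]; exact h.act_le hz _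
  have e4 := norm_id1 v k (evalC a p)
  have e5 : ‖v‖ ^ 2 ≤ ‖k‖ ^ 2 := by
    have h1 : ‖v + k * evalC a p‖ ^ 2 ≤ ‖k + v * star (evalC a p)‖ ^ 2 := by gcongr
    have h2 : 0 < 1 - ‖evalC a p‖ ^ 2 := by nlinarith [norm_nonneg (evalC a p)]
    by_contra hh
    push Not at hh
    nlinarith [mul_pos h2 (sub_pos.2 hh)]
  have e6 := norm_id2 c l p
  rw [hl, ← hk, hcn] at e6
  have e7 : (‖z‖ - ‖p‖) * ‖l‖ ≤ ‖x‖ := by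
    have := norm_sub_norm_le (c * l) (l * p)
    rw [hl, norm_mul, norm_mul, hcn] at this
    linarith
  have hd : 0 < ‖z‖ - ‖p‖ := sub_pos.2 hpz
  have e8 : ‖l‖ ^ 2 ≤ ‖x‖ ^ 2 / (‖z‖ - ‖p‖) ^ 2 := by
    rw [le_div_iff₀ (by positivity), mul_comm, ← mul_pow]
    gcongr
  have hz2 : 0 ≤ 1 - ‖z‖ ^ 2 := by nlinarith [norm_nonneg z]
  have e9 : ‖v‖ ^ 2 ≤ (1 + (1 - ‖z‖ ^ 2) / (‖z‖ - ‖p‖) ^ 2) * ‖x‖ ^ 2 := by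
    have h1 : (1 - ‖z‖ ^ 2) * (1 - ‖p‖ ^ 2) * ‖l‖ ^ 2 ≤
        (1 - ‖z‖ ^ 2) * 1 * (‖x‖ ^ 2 / (‖z‖ - ‖p‖) ^ 2) := by
      gcongr
      nlinarith [norm_nonneg p]
    calc ‖v‖ ^ 2 ≤ ‖x‖ ^ 2 + (1 - ‖z‖ ^ 2) * 1 * (‖x‖ ^ 2 / (‖z‖ - ‖p‖) ^ 2) := by linarith
      _ = _ := by ring
  have := Real.sqrt_le_sqrt e9
  rwa [Real.sqrt_sq (norm_nonneg _), Real.sqrt_mul (by positivity),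
    Real.sqrt_sq (norm_nonneg _)] at this

theorem hdq_schur {a : ℕ → H} (h : Schur a) {p : H} (hp : ‖p‖ < 1) (hw : ‖evalC a p‖ < 1)
    (ha0 : ‖a 0‖ ≤ 1) : Schur (hdqC a p) := by
  have hA := (hdq_op h hp hw ha0).1
  refine ⟨hA, fun z hz => ?_⟩
  have hdiff : DifferentiableOn ℂ (Phi (hdqC a p)) (Metric.ball 0 1) := (adm_rmul hA).diff
  have hlim : Filter.Tendsto (fun r : ℝ => Real.sqrt (1 + (1 - r ^ 2) / (r - ‖p‖) ^ 2))
      (nhdsWithin 1 (Set.Iio 1)) (nhds 1) := by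
    have hne : (1 - ‖p‖) ^ 2 ≠ 0 := by
      have : 0 < 1 - ‖p‖ := sub_pos.2 hp
      positivity
    have : ContinuousAt (fun r : ℝ => Real.sqrt (1 + (1 - r ^ 2) / (r - ‖p‖) ^ 2)) 1 := by
      fun_prop (disch := assumption)
    have h2 := this.tendsto
    simp only [one_pow, sub_self, zero_div, add_zero, Real.sqrt_one] at h2
    exact h2.mono_left nhdsWithin_le_nhds
  refine ge_of_tendsto hlim ?_
  have hmem : Set.Ioo (max ‖p‖ ‖z‖) 1 ∈ nhdsWithin (1 : ℝ) (Set.Iio 1) :=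
    Ioo_mem_nhdsLT (max_lt hp hz)
  filter_upwards [hmem] with r hr
  have hpr := (le_max_left ‖p‖ ‖z‖).trans_lt hr.1
  have hzr := (le_max_right ‖p‖ ‖z‖).trans_lt hr.1
  have hr0 : r ≠ 0 := ((norm_nonneg p).trans_lt hpr).ne'
  have hcl : DiffContOnCl ℂ (Phi (hdqC a p)) (Metric.ball 0 r) := by
    exact hdiff.diffContOnCl_ball (Metric.closedBall_subset_ball hr.2)
  refine Complex.norm_le_of_forall_mem_frontier_norm_le Metric.isBounded_ball hcl ?_
    (subset_closure (mem_ball_zero_iff.2 hzr))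
  intro y hy
  rw [frontier_ball _ hr0, mem_sphere_zero_iff_norm] at hy
  have := hdq_bound h hp hw ha0 (z := y) (by rw [hy]; exact hr.2) (by rw [hy]; exact hpr)
  rwa [hy] at this

theorem evalC_zero (a : ℕ → H) : evalC a 0 = a 0 := by
  rw [evalC, tsum_eq_single 0 (fun n hn => by simp [hn])]
  simp

theorem dq_at_zero (a : ℕ → H) : diffQuotC a 0 = fun n => a (n + 1) := by
  funext m
  rw [diffQuotC, tsum_eq_single 0 (fun n hn => by simp [hn])]
  simp

theorem schwarz_pick {a : ℕ → H} (h : Schur a) (hb : ‖a 0‖ < 1) {q : H} (hq : ‖q‖ < 1) :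
    ‖evalC a q - a 0‖ ≤ ‖q‖ * ‖1 - evalC a q * star (a 0)‖ := by
  obtain ⟨z, l, hl, hzl, hzq⟩ := exists_conj q
  have hz : ‖z‖ < 1 := by rwa [hzq]
  set b := a 0 with hbdef
  have hp : ‖(0 : H)‖ < 1 := by simp
  have ew : evalC a 0 = b := evalC_zero a
  have hw : ‖evalC a 0‖ < 1 := by rwa [ew]
  set η := l - act a z l * star b with hη
  set v := act (hdqC a 0) z η with hv
  have e1 := hdq_eq h hp hw hb.le hz η
  rw [← hv, ew, star_zero, mul_zero, sub_zero] at e1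
  have e2 := act_dq h.1 hp hz η
  rw [mul_zero, sub_zero, ew, act_smul, ← e1] at e2
  have e3 : act a z (Quaternion.ofComplex z * v * star b)
      = Quaternion.ofComplex z * act a z (v * star b) := by
    rw [mul_assoc, act_smul]
  set X := Quaternion.ofComplex z * v with hX
  set Y := act a z l - l * b with hY
  have hcomm : b * star b = star b * b := by
    rw [Quaternion.self_mul_star, Quaternion.star_mul_self]
  have e4 : X - act a z (X * star b) = act a z η - η * b := by
    rw [e3, ← e2, mul_sub]
  have e5 : Y - act a z (Y * star b) = act a z η - η * b := by
    have e : Y * star b = act a z l * star b - l * (b * star b) := by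
      rw [hY, sub_mul, mul_assoc]
    have e' : act a z (l * (b * star b)) = act a z l * (b * star b) := by
      rw [Quaternion.self_mul_star]
      have hc : ∀ y : H, y * ((Quaternion.normSq b : ℝ) : H)
          = Quaternion.ofComplex ((Quaternion.normSq b : ℝ) : ℂ) * y := by
        intro y
        have hr : Quaternion.ofComplex ((Quaternion.normSq b : ℝ) : ℂ)
            = ((Quaternion.normSq b : ℝ) : H) := by
          ext <;> simp
        rw [hr, Quaternion.coe_commutes]
      rw [hc, act_smul, hc]
    rw [e, act_sub, e', hη, act_sub, sub_mul, hcomm, mul_assoc _ (star b)]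
    rw [hY]
    abel
  have e6 : X = Y := by
    have e7 : X - Y = act a z ((X - Y) * star b) := by
      rw [sub_mul, act_sub, ← sub_eq_zero]
      rw [← e5] at e4
      rw [← sub_eq_zero] at e4
      rw [← e4]; abel
    have h8 : ‖X - Y‖ ≤ ‖X - Y‖ * ‖b‖ := by
      have := h.act_le hz ((X - Y) * star b)
      rwa [← e7, norm_mul, norm_star] at this
    by_contra hne
    have : 0 < ‖X - Y‖ := norm_pos_iff.2 (sub_ne_zero.2 hne)
    nlinarith
  have e9 : ‖Y‖ ≤ ‖z‖ * ‖η‖ := by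
    rw [← e6, hX, norm_mul, norm_ofC]
    exact mul_le_mul_of_nonneg_left ((hdq_schur h hp hw hb.le).act_le hz _) (norm_nonneg _)
  have e10 := act_eval h.1 hz hl hzl
  rw [hη, hY, e10, mul_assoc, ← mul_sub, norm_mul, hzq] at e9
  have e11 : l - l * (evalC a q * star b) = l * (1 - evalC a q * star b) := by
    rw [mul_sub, mul_one]
  rw [e11, norm_mul] at e9
  have hlp : 0 < ‖l‖ := norm_pos_iff.2 hl
  refine le_of_mul_le_mul_left ?_ hlp
  linarith

theorem hdq_coeff_zero {a : ℕ → H} (h0 : a 0 = 0) (p : H) :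
    hdqC a p 0 = diffQuotC a p 0 := by
  simp [hdqC, starMulC, starInvC, oneMinusQPbarC, h0]

theorem hdq_at_zero {a : ℕ → H} (h : Schur a) (h0 : a 0 = 0) :
    Schur (fun n => a (n + 1)) := by
  have hp : ‖(0 : H)‖ < 1 := by simp
  have ew : evalC a 0 = 0 := by rw [evalC_zero, h0]
  have hs := hdq_schur h hp (by simp [ew]) (by simp [h0])
  have hA : Adm (diffQuotC a 0) := dq_adm h.1 hp
  rw [dq_at_zero] at hA
  refine ⟨hA, fun z hz => Phi_norm_le zero_le_one fun x => ?_⟩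
  have e := hdq_eq h hp (by simp [ew]) (by simp [h0]) hz x
  rw [ew, star_zero, mul_zero, mul_zero, sub_zero, dq_at_zero] at e
  have e0 : act a z 0 = 0 := by simpa using act_sub a z 0 0
  rw [e0, sub_zero] at e
  rw [← e, one_mul]
  exact hs.act_le hz x

theorem eval_shift (a : ℕ → H) (q : H) : evalC (fun n => a (n + 1)) q = diffQuotC a q 0 := by
  simp [evalC, diffQuotC]

/-! ### scalar estimates -/

theorem nsub (x y : H) : ‖x - y‖ ^ 2 = ‖x‖ ^ 2 - 2 * (x * star y).re + ‖y‖ ^ 2 := by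
  simp only [pow_two, ← Quaternion.normSq_eq_norm_mul_self, Quaternion.normSq_def',
    Quaternion.re_mul, Quaternion.re_sub, Quaternion.imI_sub, Quaternion.imJ_sub,
    Quaternion.imK_sub, Quaternion.re_star, Quaternion.imI_star, Quaternion.imJ_star,
    Quaternion.imK_star]
  ring

theorem nsub1 (x : H) : ‖1 - x‖ ^ 2 = 1 - 2 * x.re + ‖x‖ ^ 2 := by
  have := nsub 1 x
  simpa using this

theorem re_sq_le (x : H) : x.re ^ 2 ≤ ‖x‖ ^ 2 := by
  rw [pow_two ‖x‖, ← Quaternion.normSq_eq_norm_mul_self, Quaternion.normSq_def']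
  nlinarith [sq_nonneg x.imI, sq_nonneg x.imJ, sq_nonneg x.imK]

theorem re_le_norm' (x : H) : x.re ≤ ‖x‖ :=
  (le_abs_self _).trans (abs_le_of_sq_le_sq (re_sq_le x) (norm_nonneg x))

theorem real_tri {A B C D P N r : ℝ} (hA : 0 ≤ A) (hB : 0 ≤ B) (hC : 0 ≤ C) (hD : 0 < D)
    (hr0 : 0 ≤ r) (hr1 : r < 1) (hAB : A ≤ B) (hCD : C ≤ r * D) (hP0 : 0 ≤ P)
    (hPN : P ≤ r * N) (hP : A * D - B * C ≤ P)
    (hid : N ^ 2 - P ^ 2 = (B ^ 2 - A ^ 2) * (D ^ 2 - C ^ 2)) :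
    A ≤ 2 * r / (1 + r ^ 2) * B := by
  have hCD' : C ≤ D := by nlinarith
  have hAC : A * C ≤ B * D := mul_le_mul hAB hCD' hC hB
  have h1 : A * D - B * C ≤ r * (B * D - A * C) := by
    by_cases hs : A * D - B * C ≤ 0
    · have := mul_nonneg hr0 (sub_nonneg.2 hAC)
      linarith
    · push Not at hs
      refine le_of_sq_le_sq ?_ (mul_nonneg hr0 (sub_nonneg.2 hAC))
      have h2 : (A * D - B * C) ^ 2 ≤ P ^ 2 := by gcongr
      have h3 : P ^ 2 ≤ (r * N) ^ 2 := by gcongr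
      have h4 : (A * D - B * C) ^ 2 * (1 - r ^ 2) ≤ P ^ 2 * (1 - r ^ 2) :=
        mul_le_mul_of_nonneg_right h2 (by nlinarith)
      have h5 : r ^ 2 * (N ^ 2 - P ^ 2) = r ^ 2 * ((B ^ 2 - A ^ 2) * (D ^ 2 - C ^ 2)) := by rw [hid]
      nlinarith
  have h2 : A * (D + r * C) ≤ B * (C + r * D) := by linarith
  have h3 : (C + r * D) * (1 + r ^ 2) ≤ 2 * r * (D + r * C) := by
    have : 0 ≤ (r * D - C) * (1 - r ^ 2) := mul_nonneg (by linarith) (by nlinarith)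
    linarith
  have hpos : 0 < D + r * C := by positivity
  rw [div_mul_eq_mul_div, le_div_iff₀ (by positivity)]
  refine le_of_mul_le_mul_right ?_ hpos
  have h4 := mul_le_mul_of_nonneg_left h3 hB
  have h5 := mul_le_mul_of_nonneg_right h2 (show 0 ≤ 1 + r ^ 2 by positivity)
  linarith

theorem real_bds {n R α T : ℝ} (hα0 : 0 ≤ α) (hα1 : α < 1) (hT0 : 0 ≤ T) (hT1 : T < 1)
    (hRn : R ≤ n) (hR2 : R ^ 2 ≤ n ^ 2)
    (h : n ^ 2 - 2 * α * R + α ^ 2 ≤ T ^ 2 * (1 - 2 * α * R + α ^ 2 * n ^ 2)) :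
    (α - T) / (1 - α * T) ≤ R ∧ n ≤ (α + T) / (1 + α * T) := by
  have h1 : 0 < 1 - α * T := by nlinarith
  have h2 : 0 < 1 + α * T := by positivity
  have hlt : (α - T) / (1 - α * T) ≤ (α + T) / (1 + α * T) := by
    rw [div_le_div_iff₀ h1 h2]
    nlinarith [mul_nonneg hT0 (show 0 ≤ 1 - α ^ 2 by nlinarith)]
  have hT2 : 0 ≤ 1 - T ^ 2 := by nlinarith
  have hTa : 0 ≤ 1 - T ^ 2 * α ^ 2 := by
    have : 1 - T ^ 2 * α ^ 2 = (1 - α * T) * (1 + α * T) := by ring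
    rw [this]; positivity
  constructor
  · by_contra hc
    push Not at hc
    have h3 := hc.trans_le hlt
    rw [lt_div_iff₀ h1] at hc
    rw [lt_div_iff₀ h2] at h3
    have h4 := mul_pos (sub_pos.2 hc) (sub_pos.2 h3)
    have h5 := mul_le_mul_of_nonneg_left hR2 hTa
    nlinarith
  · by_contra hc
    push Not at hc
    have h3 := hlt.trans_lt hc
    rw [div_lt_iff₀ h2] at hc
    rw [div_lt_iff₀ h1] at h3
    have h4 := mul_pos (sub_pos.2 hc) (sub_pos.2 h3)
    have h5 := mul_le_mul_of_nonneg_left hRn (mul_nonneg hα0 hT2)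
    nlinarith

theorem mob_id (α : ℝ) (h : H) : ‖h - (α : H)‖ ^ 2 = ‖h‖ ^ 2 - 2 * α * h.re + α ^ 2 ∧
    ‖1 - (α : H) * h‖ ^ 2 = 1 - 2 * α * h.re + α ^ 2 * ‖h‖ ^ 2 := by
  constructor
  · rw [nsub, Quaternion.star_coe, Quaternion.norm_coe, Real.norm_eq_abs, sq_abs]
    simp
    ring
  · rw [nsub1, norm_mul, Quaternion.norm_coe, Real.norm_eq_abs, mul_pow, sq_abs]
    simp
    ring

theorem dist_final {α r : ℝ} (hα0 : 0 ≤ α) (hα1 : α < 1) (hr0 : 0 ≤ r) (hr1 : r < 1) {h b : H}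
    (hh : ‖h‖ ≤ 1) (hb : ‖b‖ ≤ 1) (hhb : ‖h - b‖ ≤ r * ‖1 - h * star b‖)
    (hba : ‖b - (α : H)‖ ≤ r * ‖1 - (α : H) * b‖) :
    (‖h - (α : H)‖ ≤ 2 * r / (1 + r ^ 2) * ‖1 - (α : H) * h‖) ∧
    ((α * r ^ 2 - 2 * r + α) / (r ^ 2 - 2 * α * r + 1) ≤ h.re) ∧
    (h.re ≤ ‖h‖) ∧
    (‖h‖ ≤ (α * r ^ 2 + 2 * r + α) / (r ^ 2 + 2 * α * r + 1)) := by
  obtain ⟨a1, a2⟩ := mob_id α h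
  obtain ⟨b1, b2⟩ := mob_id α b
  have hα2 : 0 < 1 - α ^ 2 := by nlinarith
  have hh2 : 0 ≤ 1 - ‖h‖ ^ 2 := by nlinarith [norm_nonneg h]
  have hAB : ‖h - (α : H)‖ ≤ ‖1 - (α : H) * h‖ := by
    refine le_of_sq_le_sq ?_ (norm_nonneg _)
    rw [a1, a2]
    nlinarith [mul_nonneg hα2.le hh2]
  have hD : 0 < ‖1 - (α : H) * b‖ := by
    have := norm_sub_norm_le 1 ((α : H) * b)
    rw [norm_one, norm_mul, Quaternion.norm_coe, Real.norm_eq_abs, abs_of_nonneg hα0] at this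
    nlinarith [norm_nonneg b]
  have n1 := nsub h b
  have n2 := nsub1 (h * star b)
  rw [norm_mul, norm_star] at n2
  have hP : ‖h - (α : H)‖ * ‖1 - (α : H) * b‖ - ‖1 - (α : H) * h‖ * ‖b - (α : H)‖
      ≤ (1 - α ^ 2) * ‖h - b‖ := by
    have e : (h - (α : H)) * (1 - (α : H) * b) - (1 - (α : H) * h) * (b - (α : H))
        = ((1 - α ^ 2 : ℝ) : H) * (h - b) := by
      have hc : h * (α : H) = (α : H) * h := (Quaternion.coe_commutes α h).symm
      have hc2 : (α : H) * h * (α : H) = (α : H) * (α : H) * h := by rw [mul_assoc, hc, mul_assoc]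
      have hcast : ((1 - α ^ 2 : ℝ) : H) = 1 - (α : H) * (α : H) := by
        rw [Quaternion.coe_sub, Quaternion.coe_one, pow_two, Quaternion.coe_mul]
      rw [hcast]
      simp only [mul_sub, sub_mul, mul_one, one_mul, ← mul_assoc, hc, hc2]
      abel
    have := norm_sub_norm_le ((h - (α : H)) * (1 - (α : H) * b)) ((1 - (α : H) * h) * (b - (α : H)))
    rwa [e, norm_mul, norm_mul, norm_mul, Quaternion.norm_coe, Real.norm_eq_abs,
      abs_of_pos hα2] at this
  have main : ‖h - (α : H)‖ ≤ 2 * r / (1 + r ^ 2) * ‖1 - (α : H) * h‖ := by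
    refine real_tri (norm_nonneg _) (norm_nonneg _) (norm_nonneg _) hD hr0 hr1 hAB hba
      (P := (1 - α ^ 2) * ‖h - b‖) (N := (1 - α ^ 2) * ‖1 - h * star b‖) (by positivity)
      ?_ hP ?_
    · have := mul_le_mul_of_nonneg_left hhb hα2.le
      linarith
    · rw [mul_pow, mul_pow, n1, n2, a1, a2, b1, b2]
      ring
  refine ⟨main, ?_⟩
  set T := 2 * r / (1 + r ^ 2) with hT
  have hm : 0 < 1 + r ^ 2 := by positivity
  have hT0 : 0 ≤ T := by positivity
  have hT1 : T < 1 := by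
    rw [hT, div_lt_one hm]
    nlinarith [mul_pos (sub_pos.2 hr1) (sub_pos.2 hr1)]
  have hsq : ‖h - (α : H)‖ ^ 2 ≤ (T * ‖1 - (α : H) * h‖) ^ 2 := by gcongr
  rw [mul_pow, a1, a2] at hsq
  obtain ⟨c1, c2⟩ := real_bds hα0 hα1 hT0 hT1 (re_le_norm' h) (re_sq_le h) hsq
  have h1 : 0 < 1 - α * T := by nlinarith
  have h2 : 0 < 1 + α * T := by positivity
  have hTm : T * (1 + r ^ 2) = 2 * r := by rw [hT]; field_simp
  have f1 : (α * r ^ 2 - 2 * r + α) / (r ^ 2 - 2 * α * r + 1) = (α - T) / (1 - α * T) := by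
    rw [← mul_div_mul_right (α - T) _ hm.ne']
    congr 1
    · linear_combination hTm
    · linear_combination α * hTm
  have f2 : (α * r ^ 2 + 2 * r + α) / (r ^ 2 + 2 * α * r + 1) = (α + T) / (1 + α * T) := by
    rw [← mul_div_mul_right (α + T) _ hm.ne']
    congr 1
    · linear_combination -hTm
    · linear_combination -α * hTm
  rw [f1, f2]
  exact ⟨c1, re_le_norm' h, c2⟩

/-- Distortion estimates for the class `𝓑_α`: if `f(0) = 0` and
`∂_C f(0) = α ∈ [0,1)`, then for all `q ∈ 𝔹` the hyperbolic derivative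
`f^h(q)` satisfies the stated bounds, and so does `f⋆_q(q̄)`. -/
theorem distortion_class_Balpha (α : ℝ) (hα0 : 0 ≤ α) (hα1 : α < 1)
    (a : ℕ → H) (ha : SelfMap a) (h0 : evalC a 0 = 0) (h1 : a 1 = (α : H))
    (q : H) (hq : ‖q‖ < 1) :
    (‖evalC (hdqC a q) q - (α : H)‖ ≤
        2 * ‖q‖ / (1 + ‖q‖ ^ 2) * ‖1 - (α : H) * evalC (hdqC a q) q‖) ∧
    ((α * ‖q‖ ^ 2 - 2 * ‖q‖ + α) / (‖q‖ ^ 2 - 2 * α * ‖q‖ + 1) ≤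
        (evalC (hdqC a q) q).re) ∧
    ((evalC (hdqC a q) q).re ≤ ‖evalC (hdqC a q) q‖) ∧
    (‖evalC (hdqC a q) q‖ ≤
        (α * ‖q‖ ^ 2 + 2 * ‖q‖ + α) / (‖q‖ ^ 2 + 2 * α * ‖q‖ + 1)) ∧
    (‖evalC (hdqC a q) (star q) - (α : H)‖ ≤
        2 * ‖q‖ / (1 + ‖q‖ ^ 2) * ‖1 - (α : H) * evalC (hdqC a q) (star q)‖) ∧
    ((α * ‖q‖ ^ 2 - 2 * ‖q‖ + α) / (‖q‖ ^ 2 - 2 * α * ‖q‖ + 1) ≤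
        (evalC (hdqC a q) (star q)).re) ∧
    ((evalC (hdqC a q) (star q)).re ≤ ‖evalC (hdqC a q) (star q)‖) ∧
    (‖evalC (hdqC a q) (star q)‖ ≤
        (α * ‖q‖ ^ 2 + 2 * ‖q‖ + α) / (‖q‖ ^ 2 + 2 * α * ‖q‖ + 1)) := by
  have hs : Schur a := ha.schur
  have ha0 : a 0 = 0 := by rw [← evalC_zero a, h0]
  have hg := hdq_at_zero hs ha0
  have hb1 : ‖diffQuotC a q 0‖ ≤ 1 := by
    rw [← eval_shift]; exact hg.eval_le hq
  have hba := schwarz_pick hg (by simpa [h1, abs_of_nonneg hα0] using hα1) hq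
  simp only [eval_shift, zero_add, h1, Quaternion.star_coe] at hba
  rw [← Quaternion.coe_commutes] at hba
  have hh := hdq_schur hs hq (ha.2 q hq) (by simp [ha0])
  have hc := hdq_coeff_zero ha0 q
  have hb : ‖diffQuotC a q 0‖ < 1 := by
    by_contra hn
    have hn1 : ‖diffQuotC a q 0‖ = 1 := le_antisymm hb1 (not_lt.1 hn)
    obtain ⟨m1, m2⟩ := mob_id α (diffQuotC a q 0)
    rw [hn1] at m1 m2
    have hpos : 0 < ‖1 - (α : H) * diffQuotC a q 0‖ := by
      have := norm_sub_norm_le 1 ((α : H) * diffQuotC a q 0)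
      rw [norm_one, norm_mul, Quaternion.norm_coe, Real.norm_eq_abs, abs_of_nonneg hα0, hn1] at this
      linarith
    have h3 : ‖diffQuotC a q 0 - (α : H)‖ = ‖1 - (α : H) * diffQuotC a q 0‖ := by
      rw [← sq_eq_sq₀ (norm_nonneg _) (norm_nonneg _), m1, m2]; ring
    rw [h3] at hba
    nlinarith
  have key : ∀ y : H, ‖y‖ = ‖q‖ → _ := fun y hy => by
    have hy1 : ‖y‖ < 1 := by rwa [hy]
    have h3 := schwarz_pick hh (by rwa [hc]) hy1
    rw [hc, hy] at h3
    exact dist_final hα0 hα1 (norm_nonneg q) hq (hh.eval_le hy1) hb1 h3 hba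
  obtain ⟨k1, k2, k3, k4⟩ := key q rfl
  obtain ⟨l1, l2, l3, l4⟩ := key (star q) (norm_star q)
  exact ⟨k1, k2, k3, k4, l1, l2, l3, l4⟩

end QPaper
end
end
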